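/- arXiv:2603.22185 — 4 statements merged into one kernel-verified Lean document; each statement's English description precedes it below -/
import Mathlib

section
/- Suppose A is a crossed product (R, C_m, σ, α): an F-algebra containing R as a subalgebra, free as a left R-module with basis (u_g)_{g ∈ C_m}, such that u_1 = 1, u_g x = σ_g(x) u_g for all x ∈ R and g ∈ C_m, and u_g u_{g'} = α(g, g') u_{g g'} for all g, g' ∈ C_m. Then A is isomorphic, as an F-algebra, to the algebra M_t(B) of t × t matrices over B, for any crossed product B = (K, H, σ|_H, α|_H) of the stabilizer H over K with the restricted action and cocycle. -/
/-- The `F`-linear map `∑ y_g • g ↦ ∑ f y_g * u g` attached to a linear map `f : R → A` and a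
family `u` of elements of `A`. -/
noncomputable def crossedSum {F R A G : Type*} [Field F] [AddCommGroup R] [Module F R] [Ring A]
    [Algebra F A] (f : R →ₗ[F] A) (u : G → A) : (G →₀ R) →ₗ[F] A :=
  Finsupp.lsum F fun g => LinearMap.mulRight F (u g) ∘ₗ f

theorem crossedSum_apply {F R A G : Type*} [Field F] [AddCommGroup R] [Module F R] [Ring A]
    [Algebra F A] (f : R →ₗ[F] A) (u : G → A) (c : G →₀ R) :
    crossedSum f u c = c.sum fun g y => f y * u g := by
  rfl

theorem crossedSum_single {F R A G : Type*} [Field F] [AddCommGroup R] [Module F R] [Ring A]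
    [Algebra F A] (f : R →ₗ[F] A) (u : G → A) (g : G) (y : R) :
    crossedSum f u (Finsupp.single g y) = f y * u g := by
  simp [crossedSum]

theorem crossedSum_bijective {F R A G : Type*} [Field F] [AddCommGroup R] [Module F R] [Ring A]
    [Algebra F A] (f : R →ₗ[F] A) (u : G → A)
    (h : ∀ x : A, ∃! c : G →₀ R, x = c.sum fun g y => f y * u g) :
    Function.Bijective (crossedSum f u) := by
  refine (Function.bijective_iff_existsUnique _).2 fun x => ?_
  simpa only [crossedSum_apply, eq_comm] using h x

/-- If `1 = ∑ wᵢ e wᵢ⁻¹` is a decomposition into orthogonal idempotents and `B` is identified with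
the corner `e A e`, then `A` is a matrix algebra over `B`. -/
theorem nonempty_algEquiv_matrix_of_corner {F A B ι : Type*} [Field F] [Ring A] [Algebra F A]
    [Ring B] [Algebra F B] [Fintype ι] [DecidableEq ι] (e : A) (w : ι → Aˣ)
    (hsum : ∑ i, (w i : A) * e * ((w i)⁻¹ : Aˣ) = 1)
    (horth : ∀ i j, i ≠ j → e * ((w i)⁻¹ : Aˣ) * (w j : A) * e = 0)
    (φ : B →ₗ[F] A) (hinj : Function.Injective φ) (hmul : ∀ x y, φ (x * y) = φ x * φ y)
    (hone : φ 1 = e) (hsurj : ∀ a, ∃ b, φ b = e * a * e) :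
    Nonempty (A ≃ₐ[F] Matrix ι ι B) := by
  have hl (b : B) : e * φ b = φ b := by rw [← hone, ← hmul, one_mul]
  have hr (b : B) : φ b * e = φ b := by rw [← hone, ← hmul, mul_one]
  have he : e * e = e := by rw [← hone, ← hmul, one_mul]
  have hmid (b c : B) (j k : ι) :
      φ b * ((w j)⁻¹ : Aˣ) * ((w k : A) * φ c) = if j = k then φ (b * c) else 0 := by
    split_ifs with h
    · subst h
      rw [hmul, mul_assoc, Units.inv_mul_cancel_left]
    · calc _ = φ b * (e * ((w j)⁻¹ : Aˣ) * (w k : A) * e) * φ c := by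
            rw [← hr b, ← hl c]; simp only [mul_assoc, ← mul_assoc e e, he]
        _ = 0 := by rw [horth j k h, mul_zero, zero_mul]
  let Φ : Matrix ι ι B →ₗ[F] A :=
    { toFun := fun b => ∑ i, ∑ j, (w i : A) * φ (b i j) * ((w j)⁻¹ : Aˣ)
      map_add' := fun b c => by
        simp only [Matrix.add_apply, map_add, mul_add, add_mul, Finset.sum_add_distrib]
      map_smul' := fun r b => by
        simp only [Matrix.smul_apply, map_smul, mul_smul_comm, smul_mul_assoc, Finset.smul_sum,
          RingHom.id_apply] }
  have hΦ (b) : Φ b = ∑ i, ∑ j, (w i : A) * φ (b i j) * ((w j)⁻¹ : Aˣ) := rfl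
  have hΦone : Φ 1 = 1 := by
    rw [hΦ, ← hsum]
    refine Finset.sum_congr rfl fun i _ => ?_
    rw [Finset.sum_eq_single i]
    · simp [hone]
    · intro j _ hj
      simp [Matrix.one_apply_ne' hj]
    · simp
  have hΦmul (b c) : Φ (b * c) = Φ b * Φ c := by
    have hterm (i j k l : ι) :
        (w i : A) * φ (b i j) * ((w j)⁻¹ : Aˣ) * ((w k : A) * φ (c k l) * ((w l)⁻¹ : Aˣ)) =
          if j = k then (w i : A) * φ (b i j * c k l) * ((w l)⁻¹ : Aˣ) else 0 := by
      calc _ = (w i : A) * (φ (b i j) * ((w j)⁻¹ : Aˣ) * ((w k : A) * φ (c k l))) *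
            ((w l)⁻¹ : Aˣ) := by simp only [mul_assoc]
        _ = _ := by rw [hmid]; split_ifs <;> simp
    simp only [hΦ, Finset.sum_mul, Finset.mul_sum, hterm, Matrix.mul_apply, map_sum]
    simp only [Finset.sum_ite_eq', Finset.mem_univ, if_true]
    refine Finset.sum_comm.trans (Eq.trans ?_ Finset.sum_comm)
    exact Finset.sum_congr rfl fun l _ => Finset.sum_comm
  have hentry (b : Matrix ι ι B) (i j : ι) :
      e * ((w i)⁻¹ : Aˣ) * Φ b * ((w j : A) * e) = φ (b i j) := by
    have hterm (k l : ι) : e * ((w i)⁻¹ : Aˣ) * ((w k : A) * φ (b k l) * ((w l)⁻¹ : Aˣ)) *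
        ((w j : A) * e) = if i = k then if l = j then φ (b k l) else 0 else 0 := by
      calc _ = (φ 1 * ((w i)⁻¹ : Aˣ) * ((w k : A) * φ (b k l))) * ((w l)⁻¹ : Aˣ) *
            ((w j : A) * φ 1) := by simp only [hone, mul_assoc]
        _ = _ := by
          rw [hmid]
          split_ifs with h h'
          · rw [hmid, if_pos h', one_mul, mul_one]
          · rw [hmid, if_neg h']
          · simp
    simp [hΦ, Finset.sum_mul, Finset.mul_sum, hterm]
  have hbij : Function.Bijective Φ := by
    refine ⟨fun b c h => ?_, fun a => ?_⟩
    · ext i j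
      apply hinj
      rw [← hentry b, h, hentry]
    · choose s hs using hsurj
      refine ⟨Matrix.of fun i j => s (((w i)⁻¹ : Aˣ) * a * w j), ?_⟩
      rw [hΦ]
      calc _ = (∑ i, (w i : A) * e * ((w i)⁻¹ : Aˣ)) * a *
            ∑ j, (w j : A) * e * ((w j)⁻¹ : Aˣ) := by
            simp only [Matrix.of_apply, hs, Finset.sum_mul, Finset.mul_sum, mul_assoc]
            exact Finset.sum_comm
        _ = a := by rw [hsum, one_mul, mul_one]
  exact ⟨(AlgEquiv.ofBijective (AlgHom.ofLinearMap Φ hΦone hΦmul) hbij).symm⟩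

/-- **Passman.** Let `K` be a field, `F` a subfield, `R = K × ⋯ × K`
(`t` factors) an `F`-algebra, and let the cyclic group `C_m` (here `M`, cyclic of
order `m`) act on `R` by `F`-algebra automorphisms via `σ`, permuting the `t`
primitive idempotents transitively. Let `H ≤ M` be the stabilizer of the first
factor (of order `h = m/t`), acting on `K` via `σK`, and let `α` be a normalized
2-cocycle on `M` with values in `Fˣ` (trivial action). If `A` is a crossed product
`(R, C_m, σ, α)` and `B` is a crossed product `(K, H, σ|_H, α|_H)`, then
`A ≅ M_t(B)` as `F`-algebras. -/
theorem crossedProduct_matrix_reduction (F K : Type) [Field F] [Field K] [Algebra F K]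
    (t m : ℕ) (ht : 0 < t) (hm : 0 < m)
    (M : Type) [Group M] [IsCyclic M] (hM : Nat.card M = m)
    (σ : M →* ((Fin t → K) ≃ₐ[F] (Fin t → K)))
    (hperm : ∀ (g : M) (i : Fin t), ∃ j : Fin t,
      σ g (Pi.single i (1 : K)) = Pi.single j (1 : K))
    (htrans : ∀ i j : Fin t, ∃ g : M,
      σ g (Pi.single i (1 : K)) = Pi.single j (1 : K))
    (α : M → M → Fˣ)
    (hcoc : ∀ x y z : M, α x y * α (x * y) z = α y z * α x (y * z))
    (hnorm : ∀ x : M, α x 1 = 1 ∧ α 1 x = 1)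
    -- the stabilizer `H` of the first factor, of order `h = m/t`
    (H : Subgroup M)
    (hH : ∀ g : M, g ∈ H ↔
      σ g (Pi.single (⟨0, ht⟩ : Fin t) (1 : K)) = Pi.single (⟨0, ht⟩ : Fin t) (1 : K))
    (hHcard : Nat.card H = m / t)
    -- the action of `H` on `K`, identified with the first factor
    (σK : H →* (K ≃ₐ[F] K))
    (hσK : ∀ (τ : H) (x : K),
      σ (τ : M) (Pi.single (⟨0, ht⟩ : Fin t) x) = Pi.single (⟨0, ht⟩ : Fin t) (σK τ x))
    -- `A`, a crossed product `(R, C_m, σ, α)`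
    (A : Type) [Ring A] [Algebra F A]
    (ιR : (Fin t → K) →ₐ[F] A) (hιR : Function.Injective ιR)
    (u : M → A) (hu1 : u 1 = 1)
    (huσ : ∀ (g : M) (x : Fin t → K), u g * ιR x = ιR (σ g x) * u g)
    (huu : ∀ g g' : M, u g * u g' = algebraMap F A ((α g g' : F)) * u (g * g'))
    (hufree : ∀ x : A, ∃! c : M →₀ (Fin t → K), x = c.sum fun g y => ιR y * u g)
    -- `B`, a crossed product `(K, H, σ|_H, α|_H)`
    (B : Type) [Ring B] [Algebra F B]
    (ιK : K →ₐ[F] B) (hιK : Function.Injective ιK)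
    (v : H → B) (hv1 : v 1 = 1)
    (hvσ : ∀ (τ : H) (x : K), v τ * ιK x = ιK (σK τ x) * v τ)
    (hvv : ∀ τ τ' : H, v τ * v τ' = algebraMap F B ((α (τ : M) (τ' : M) : F)) * v (τ * τ'))
    (hvfree : ∀ x : B, ∃! c : H →₀ K, x = c.sum fun τ y => ιK y * v τ) :
    Nonempty (A ≃ₐ[F] Matrix (Fin t) (Fin t) B) := by
  set z : Fin t := ⟨0, ht⟩
  let e : A := ιR (Pi.single z 1)
  have hunit (g : M) : IsUnit (u g) := by
    have hα (x y : M) : IsUnit (algebraMap F A (α x y : F)) := (α x y).isUnit.map _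
    obtain ⟨a, ha⟩ := (hα g g⁻¹).exists_right_inv
    obtain ⟨b, hb⟩ := (hα g⁻¹ g).exists_left_inv
    refine isUnit_iff_exists_and_exists.2 ⟨⟨u g⁻¹ * a, ?_⟩, ⟨b * u g⁻¹, ?_⟩⟩
    · rw [← mul_assoc, huu, mul_inv_cancel, hu1, mul_one, ha]
    · rw [mul_assoc, huu, inv_mul_cancel, hu1, mul_one, hb]
  choose g hg using htrans z
  let w (i : Fin t) : Aˣ := (hunit (g i)).unit
  have hw (i : Fin t) : (w i : A) * e * ((w i)⁻¹ : Aˣ) = ιR (Pi.single i 1) := by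
    rw [Units.mul_inv_eq_iff_eq_mul]
    change u (g i) * ιR _ = _ * u (g i)
    rw [huσ, hg]
  let f : K →ₗ[F] A := ιR.toLinearMap ∘ₗ LinearMap.single F (fun _ : Fin t => K) z
  have hf (x : K) : f x = ιR (Pi.single z x) := rfl
  let β : (H →₀ K) ≃ₗ[F] B :=
    LinearEquiv.ofBijective (crossedSum ιK.toLinearMap v) (crossedSum_bijective _ _ hvfree)
  have hβ (τ : H) (y : K) : β (Finsupp.single τ y) = ιK y * v τ := crossedSum_single _ _ _ _
  let φ : B →ₗ[F] A := crossedSum f (fun τ : H => u τ) ∘ₗ β.symm.toLinearMap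
  have hφβ (c : H →₀ K) : φ (β c) = crossedSum f (fun τ : H => u τ) c := by simp [φ]
  have hφ (τ : H) (y : K) : φ (ιK y * v τ) = ιR (Pi.single z y) * u τ := by
    rw [← hβ, hφβ, crossedSum_single, hf]
  refine nonempty_algEquiv_matrix_of_corner e w ?_ ?_ φ ?_ ?_ ?_ ?_
  · simp only [hw]
    rw [← map_sum, Finset.univ_sum_single (fun _ : Fin t => (1 : K))]
    exact map_one ιR
  · intro i j hij
    have h : (w i : A) * (e * ((w i)⁻¹ : Aˣ) * (w j : A) * e) * ((w j)⁻¹ : Aˣ) = 0 := by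
      calc _ = ((w i : A) * e * ((w i)⁻¹ : Aˣ)) * ((w j : A) * e * ((w j)⁻¹ : Aˣ)) := by
            simp only [mul_assoc]
        _ = 0 := by
          rw [hw, hw, ← map_mul, ← Pi.single_mul_left]
          simp [hij]
    simpa using h
  · suffices h : Function.Injective (crossedSum f fun τ : H => u τ) from
      h.comp β.symm.injective
    have h (c : H →₀ K) : crossedSum f (fun τ : H => u τ) c = crossedSum ιR.toLinearMap u
        ((c.mapRange (Pi.single z) (Pi.single_zero z)).mapDomain ((↑) : H → M)) := by
      rw [crossedSum_apply, crossedSum_apply, Finsupp.sum_mapDomain_index,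
        Finsupp.sum_mapRange_index]
      · rfl
      · simp
      · simp
      · simp [add_mul]
    intro c d hcd
    rw [h, h] at hcd
    exact Finsupp.mapRange_injective _ (Pi.single_zero z) (Pi.single_injective z)
      (Finsupp.mapDomain_injective Subtype.val_injective
        ((crossedSum_bijective ιR.toLinearMap u hufree).1 hcd))
  · suffices h : (LinearMap.mul F B).compr₂ φ = (LinearMap.mul F A).compl₁₂ φ φ from
      fun x y => LinearMap.congr_fun₂ h x y
    have hgen (τ ρ : H) (x y : K) : φ (ιK x * v τ * (ιK y * v ρ)) =
        φ (ιK x * v τ) * φ (ιK y * v ρ) := by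
      have hB : ιK x * v τ * (ιK y * v ρ) =
          (α τ ρ : F) • (ιK (x * σK τ y) * v (τ * ρ)) := by
        calc _ = ιK x * (v τ * ιK y) * v ρ := by simp only [mul_assoc]
          _ = ιK (x * σK τ y) * (v τ * v ρ) := by rw [hvσ, map_mul]; simp only [mul_assoc]
          _ = _ := by rw [hvv, ← Algebra.smul_def, mul_smul_comm]
      have hA : ιR (Pi.single z x) * u τ * (ιR (Pi.single z y) * u ρ) =
          (α τ ρ : F) • (ιR (Pi.single z (x * σK τ y)) * u (τ * ρ : H)) := by
        calc _ = ιR (Pi.single z x) * (u τ * ιR (Pi.single z y)) * u ρ := by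
              simp only [mul_assoc]
          _ = ιR (Pi.single z (x * σK τ y)) * (u τ * u ρ) := by
            rw [huσ, hσK, Pi.single_mul, map_mul]; simp only [mul_assoc]
          _ = _ := by rw [huu, ← Algebra.smul_def, mul_smul_comm, Subgroup.coe_mul]
      rw [hB, map_smul, hφ, hφ, hφ, hA]
    refine LinearMap.ext fun x => LinearMap.ext fun y => ?_
    obtain ⟨c, rfl⟩ := β.surjective x
    obtain ⟨d, rfl⟩ := β.surjective y
    change φ (β c * β d) = φ (β c) * φ (β d)
    induction c using Finsupp.induction_linear with
    | zero => simp
    | add c c' hc hc' => simp only [map_add, add_mul, hc, hc']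
    | single τ x =>
      induction d using Finsupp.induction_linear with
      | zero => simp
      | add d d' hd hd' => simp only [map_add, mul_add, hd, hd']
      | single ρ y => rw [hβ, hβ, hgen]
  · have h := hφ 1 1
    rwa [map_one, hv1, one_mul, Subgroup.coe_one, hu1, mul_one] at h
  · intro a
    obtain ⟨c, rfl⟩ := (crossedSum_bijective ιR.toLinearMap u hufree).2 a
    change _ ∈ LinearMap.range φ
    induction c using Finsupp.induction_linear with
    | zero => simp
    | add c d hc hd =>
      rw [map_add, mul_add, add_mul]
      exact add_mem hc hd
    | single k y =>
      have h : e * (ιR y * u k) * e =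
          ιR (Pi.single z (y z) * σ k (Pi.single z 1)) * u k := by
        calc _ = e * ιR y * (u k * e) := by simp only [mul_assoc]
          _ = _ := by
            rw [huσ, ← map_mul, ← mul_assoc, ← map_mul, ← Pi.single_mul_left, one_mul]
      rw [crossedSum_single, AlgHom.toLinearMap_apply, h]
      obtain ⟨j, hj⟩ := hperm k z
      by_cases hjz : z = j
      · subst hjz
        refine ⟨ιK (y z) * v ⟨k, (hH k).2 hj⟩, ?_⟩
        simp only [hφ, hj, ← Pi.single_mul, mul_one]
      · rw [hj, ← Pi.single_mul_left, Pi.single_eq_of_ne hjz, mul_zero, Pi.single_zero, map_zero,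
          zero_mul]
        exact zero_mem _
end

section
/- Suppose the action of H on K is faithful, i.e. σ is injective. Then there exist a positive integer ρ and an F-algebra isomorphism B ≅ M_ρ(K^{σ(H)}), the ρ × ρ matrix algebra over the fixed field K^{σ(H)}, where ρ satisfies ρ² · [K^{σ(H)} : F] = h · f; equivalently ρ² = h · s where s = |σ(H)|, so that h · s is a perfect square. -/
/-- For finite fields, every scalar is a norm, computed along a generator of the Galois group. -/
theorem exists_prod_range_galois_eq {E K H : Type*} [Field E] [Field K] [Algebra E K] [Finite K]
    [Group H] (s : H ≃* Gal(K/E)) {g : H} (hg : ∀ x, x ∈ Subgroup.zpowers g) (a : E) :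
    ∃ x : K, ∏ i ∈ Finset.range (orderOf g), s (g ^ i) x = algebraMap E K a := by
  classical
  have : Finite H := Finite.of_equiv _ s.symm.toEquiv
  have := Fintype.ofFinite H
  obtain ⟨x, rfl⟩ := FiniteField.norm_surjective E K a
  refine ⟨x, ?_⟩
  have := Finite.of_injective _ (algebraMap E K).injective
  rw [Algebra.norm_eq_prod_automorphisms, ← s.toEquiv.prod_comp,
    ← IsCyclic.image_range_orderOf hg, Finset.prod_image]
  · rfl
  · intro i hi j hj hij
    exact pow_injOn_Iio_orderOf (by simpa using hi) (by simpa using hj) hij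

/-- A crossed product of a finite field by a Galois group, with cocycle values in a subfield of
the centre, admits a multiplicative system of semilinear generators. -/
theorem exists_monoidHom_semilinear {F E K H B : Type*} [Field F] [Field E] [Field K]
    [Algebra F E] [Algebra E K] [Algebra F K] [IsScalarTower F E K] [Finite K] [Group H]
    (s : H ≃* Gal(K/E)) [Ring B] [Algebra F B] (ι : K →ₐ[F] B) (u : H → B) (hu1 : u 1 = 1)
    (α : H → H → Fˣ) (hus : ∀ (τ : H) (x : K), u τ * ι x = ι (s τ x) * u τ)
    (huu : ∀ τ τ' : H, u τ * u τ' = algebraMap F B (α τ τ' : F) * u (τ * τ')) :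
    ∃ (w : H →* B) (b : H → Kˣ), ∀ τ, w τ = ι (b τ) * u τ := by
  have : Finite H := Finite.of_equiv _ s.symm.toEquiv
  have := Finite.of_injective _ (algebraMap E K).injective
  have : IsCyclic H := isCyclic_of_injective s.toMonoidHom s.injective
  obtain ⟨g, hg⟩ := IsCyclic.exists_generator (α := H)
  have hupow : ∀ n : ℕ, ∃ a : Fˣ, u g ^ n = algebraMap F B a * u (g ^ n) := by
    intro n
    induction n with
    | zero => exact ⟨1, by simp [hu1]⟩
    | succ n ih =>
      obtain ⟨a, ha⟩ := ih
      exact ⟨a * α (g ^ n) g, by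
        rw [pow_succ, ha, mul_assoc, huu, ← pow_succ, ← mul_assoc, Units.val_mul, map_mul]⟩
  have hvpow : ∀ (x : K) (n : ℕ),
      (ι x * u g) ^ n = ι (∏ i ∈ Finset.range n, s (g ^ i) x) * u g ^ n := by
    intro x n
    induction n with
    | zero => simp
    | succ n ih =>
      obtain ⟨a, ha⟩ := hupow n
      have hcomm : u g ^ n * ι x = ι (s (g ^ n) x) * u g ^ n := by
        rw [ha, mul_assoc, hus, ← mul_assoc, ← mul_assoc, Algebra.commutes]
      rw [pow_succ, ih, Finset.prod_range_succ, map_mul, pow_succ, mul_assoc,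
        ← mul_assoc (u g ^ n), hcomm]
      simp only [mul_assoc]
  obtain ⟨a, ha⟩ := hupow (orderOf g)
  obtain ⟨x, hx⟩ := exists_prod_range_galois_eq s hg (algebraMap F E (a⁻¹ : Fˣ))
  have hx0 : x ≠ 0 := by
    rintro rfl
    have hzero : ∏ i ∈ Finset.range (orderOf g), s (g ^ i) (0 : K) = 0 :=
      Finset.prod_eq_zero (Finset.mem_range.2 (orderOf_pos g)) (map_zero _)
    rw [hzero, eq_comm, map_eq_zero, map_eq_zero] at hx
    exact a⁻¹.ne_zero hx
  have hv : (ι x * u g) ^ orderOf g = 1 := by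
    rw [hvpow, hx, ha, pow_orderOf_eq_one, hu1, mul_one, ← IsScalarTower.algebraMap_apply,
      AlgHom.commutes, ← map_mul, ← Units.val_mul, inv_mul_cancel, Units.val_one, map_one]
  let v : Bˣ := Units.ofPowEqOne _ _ hv (orderOf_pos g).ne'
  have hvg : orderOf v ∣ orderOf g :=
    orderOf_dvd_of_pow_eq_one (Units.ext hv)
  let w := (Units.coeHom B).comp (monoidHomOfForallMemZpowers hg hvg)
  have hw : ∀ τ, ∃ b : Kˣ, w τ = ι b * u τ := by
    intro τ
    obtain ⟨n, rfl⟩ := mem_powers_iff_mem_zpowers.2 (hg τ)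
    obtain ⟨a, ha⟩ := hupow n
    refine ⟨Units.mk0 ((∏ i ∈ Finset.range n, s (g ^ i) x) * algebraMap F K a) ?_, ?_⟩
    · refine mul_ne_zero (Finset.prod_ne_zero_iff.2 fun i _ => ?_) (by simp)
      exact (map_ne_zero (s (g ^ i))).2 hx0
    · have hwg : w g = ι x * u g := by
        simp [w, v]
      simp only [map_pow, hwg, hvpow, ha, Units.val_mk0, map_mul, AlgHom.commutes, mul_assoc]
  choose b hb using hw
  exact ⟨w, b, hb⟩

/-- The skew group algebra of a finite Galois extension is its algebra of linear endomorphisms. -/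
theorem nonempty_algEquiv_end_of_semilinear {F E K H B : Type*} [Field F] [Field E] [Field K]
    [Algebra F E] [Algebra E K] [Algebra F K] [IsScalarTower F E K] [FiniteDimensional F K]
    [IsGalois E K] [Group H] [Fintype H] (s : H ≃* Gal(K/E)) [Ring B] [Algebra F B]
    (ι : K →ₐ[F] B) (w : H →* B) (hws : ∀ (τ : H) (x : K), w τ * ι x = ι (s τ x) * w τ)
    (hbij : Function.Bijective fun c : H → K => ∑ τ, ι (c τ) * w τ) :
    Nonempty (B ≃ₐ[F] Module.End E K) := by
  classical
  have : FiniteDimensional F E := .left F E K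
  have : FiniteDimensional E K := .right F E K
  let S : (H → K) ≃ₗ[F] B := .ofBijective
    { toFun := fun c => ∑ τ, ι (c τ) * w τ
      map_add' := fun c d => by simp [add_mul, Finset.sum_add_distrib]
      map_smul' := fun r c => by simp [Finset.smul_sum] } hbij
  let R : (H → K) →ₗ[F] Module.End E K :=
    { toFun := fun c => ∑ τ, c τ • (s τ).toLinearMap
      map_add' := fun c d => by simp [add_smul, Finset.sum_add_distrib]
      map_smul' := fun r c => by simp [Finset.smul_sum] }
  have hS : ∀ c, S c = ∑ τ, ι (c τ) * w τ := fun _ => rfl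
  have hR : ∀ c, R c = ∑ τ, c τ • (s τ).toLinearMap := fun _ => rfl
  have hRinj : Function.Injective R := by
    have hli : LinearIndependent K fun τ : H => (s τ).toLinearMap :=
      (linearIndependent_toLinearMap E K K).comp (fun τ => (s τ : K →ₐ[E] K))
        fun τ τ' h => s.injective (AlgEquiv.coe_toAlgHom_injective h)
    refine (injective_iff_map_eq_zero R).2 fun c hc => funext ?_
    exact Fintype.linearIndependent_iff.1 hli c hc
  have hcard : Fintype.card H = Module.finrank E K := by
    rw [← IsGalois.card_aut_eq_finrank, ← Nat.card_eq_fintype_card, Nat.card_congr s.toEquiv]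
  have hdim : Module.finrank F (H → K) = Module.finrank F (Module.End E K) := by
    rw [Module.finrank_pi_fintype, ← Module.finrank_mul_finrank F E (Module.End E K),
      Module.finrank_linearMap, Finset.sum_const, Finset.card_univ, hcard,
      ← Module.finrank_mul_finrank F E K, smul_eq_mul]
    ring
  have hRbij : Function.Bijective R :=
    ⟨hRinj, (LinearMap.injective_iff_surjective_of_finrank_eq_finrank hdim).1 hRinj⟩
  let T : B ≃ₗ[F] Module.End E K := S.symm.trans (.ofBijective R hRbij)
  have hT : ∀ (y : K) (τ : H), T (ι y * w τ) = y • (s τ).toLinearMap := by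
    intro y τ
    have hSy : ι y * w τ = S (Pi.single τ y) := by
      rw [hS, Finset.sum_eq_single τ] <;> simp +contextual
    have hRy : R (Pi.single τ y) = y • (s τ).toLinearMap := by
      rw [hR, Finset.sum_eq_single τ] <;> simp +contextual
    rw [hSy, ← hRy]
    simp [T]
  refine ⟨.ofLinearEquiv T ?_ fun x y => ?_⟩
  · have := hT 1 1
    rw [map_one, map_one, one_mul] at this
    rw [this]
    ext z
    simp
  · obtain ⟨c, rfl⟩ := S.surjective x
    obtain ⟨d, rfl⟩ := S.surjective y
    simp only [hS, Finset.sum_mul_sum, map_sum]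
    refine Finset.sum_congr rfl fun τ _ => Finset.sum_congr rfl fun τ' _ => ?_
    have hmul : ι (c τ) * w τ * (ι (d τ') * w τ') = ι (c τ * s τ (d τ')) * w (τ * τ') := by
      rw [mul_assoc, ← mul_assoc (w τ), hws, map_mul, map_mul]
      simp only [mul_assoc]
    rw [hmul, hT, hT, hT]
    ext z
    simp [mul_assoc]


/-- Let `F ⊆ K` be finite fields with `[K : F] = f`, let `H` be a
finite group of order `h` acting faithfully on `K` via `σ : H → Gal(K/F)` (σ
injective), let `α` be a normalized 2-cocycle with values in `Fˣ` (trivial action),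
and let `B = (K, H, σ, α)` be a crossed product. Then there exist a positive integer
`ρ` and an `F`-algebra isomorphism `B ≅ M_ρ(K^{σ(H)})`, where
`ρ² · [K^{σ(H)} : F] = h·f`; equivalently `ρ² = h·s` with `s = |σ(H)|`, so that
`h·s` is a perfect square. -/
theorem crossedProduct_matrix_over_fixedField (F K : Type) [Field F] [Field K]
    [Algebra F K] [Finite F] [Finite K]
    (f : ℕ) (hf : Module.finrank F K = f)
    (H : Type) [Group H] [Finite H]
    (h : ℕ) (hh : Nat.card H = h)
    (σ : H →* (K ≃ₐ[F] K)) (hσ : Function.Injective σ)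
    (s : ℕ) (hs : Nat.card σ.range = s)
    (α : H → H → Fˣ)
    (hcoc : ∀ x y z : H, α x y * α (x * y) z = α y z * α x (y * z))
    (hnorm : ∀ x : H, α x 1 = 1 ∧ α 1 x = 1)
    (B : Type) [Ring B] [Algebra F B]
    (ιK : K →ₐ[F] B) (hιK : Function.Injective ιK)
    (u : H → B) (hu1 : u 1 = 1)
    (huσ : ∀ (τ : H) (x : K), u τ * ιK x = ιK (σ τ x) * u τ)
    (huu : ∀ τ τ' : H, u τ * u τ' = algebraMap F B ((α τ τ' : F)) * u (τ * τ'))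
    (hufree : ∀ x : B, ∃! c : H →₀ K, x = c.sum fun τ y => ιK y * u τ) :
    ∃ ρ : ℕ, 0 < ρ ∧
      ρ ^ 2 * Module.finrank F (IntermediateField.fixedField σ.range) = h * f ∧
      ρ ^ 2 = h * s ∧
      Nonempty (B ≃ₐ[F]
        Matrix (Fin ρ) (Fin ρ) (IntermediateField.fixedField σ.range)) := by
  have := Fintype.ofFinite H
  let E := IntermediateField.fixedField σ.range
  let e : H ≃* Gal(K/E) :=
    (MonoidHom.ofInjective hσ).trans (IntermediateField.subgroupEquivAlgEquiv σ.range)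
  have heσ : ∀ τ x, e τ x = σ τ x := fun _ _ => rfl
  have hsh : s = h := by
    rw [← hs, ← hh, Nat.card_congr (MonoidHom.ofInjective hσ).toEquiv]
  have hrank : Module.finrank E K = h := by
    rw [IntermediateField.finrank_fixedField_eq_card, hs, hsh]
  refine ⟨h, hh ▸ Nat.card_pos, ?_, by rw [hsh, sq], ?_⟩
  · rw [← hf, ← Module.finrank_mul_finrank F E K, hrank]
    ring
  obtain ⟨w, b, hw⟩ := exists_monoidHom_semilinear e ιK u hu1 α huσ huu
  have hws : ∀ (τ : H) (x : K), w τ * ιK x = ιK (e τ x) * w τ := by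
    intro τ x
    rw [hw, mul_assoc, huσ, ← mul_assoc, ← mul_assoc, ← map_mul, ← map_mul, mul_comm, heσ]
  have hsum : ∀ c : H → K, ∑ τ, ιK (c τ) * w τ =
      (Finsupp.equivFunOnFinite.symm fun τ => c τ * b τ).sum fun τ y => ιK y * u τ := by
    intro c
    rw [Finsupp.sum_fintype _ _ (by simp)]
    simp [hw, mul_assoc]
  have hbij : Function.Bijective fun c : H → K => ∑ τ, ιK (c τ) * w τ := by
    constructor
    · intro c d hcd
      have heq := (hufree _).unique (hsum c) (hcd.trans (hsum d))
      funext τ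
      simpa using DFunLike.congr_fun heq τ
    · intro x
      obtain ⟨c, hc, -⟩ := hufree x
      refine ⟨fun τ => c τ * (b τ)⁻¹, ?_⟩
      simp only [hsum]
      rw [hc]
      congr 1
      ext τ
      simp
  obtain ⟨φ⟩ := nonempty_algEquiv_end_of_semilinear e ιK w hws hbij
  exact ⟨φ.trans ((algEquivMatrix (Module.finBasisOfFinrankEq E K hrank)).restrictScalars F)⟩
end

section
/- The integer h · s is a perfect square; write ρ = √(h · s) and u = (p − 1)/(f · t). Then there is an F-algebra isomorphism A ≅ F[X]/(X^m − λ) × ∏_{j=1}^{u} M_{t·ρ}(K_j), where each K_j is a field extension of F of degree d = f/s. In particular dim_F A = p · m = |G|. -/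
/-- Coset representatives for the subgroup generated by two elements of a finite abelian group. -/
theorem exists_cosetReps {C : Type*} [CommGroup C] [Finite C] (x y : C) :
    orderOf y * orderOf (QuotientGroup.mk x : C ⧸ Subgroup.zpowers y) ∣ Nat.card C ∧
    ∃ κ : Fin (Nat.card C / (orderOf y * orderOf (QuotientGroup.mk x : C ⧸ Subgroup.zpowers y))) → C,
      ∀ g, ∃ (k : _) (n e : ℕ), g = κ k * x ^ n * y ^ e := by
  set S := Subgroup.zpowers (QuotientGroup.mk x : C ⧸ Subgroup.zpowers y)
  set H := S.comap (QuotientGroup.mk' (Subgroup.zpowers y)) with hH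
  have hidx : H.index = S.index :=
    Subgroup.index_comap_of_surjective _ (QuotientGroup.mk'_surjective _)
  have hcard : Nat.card C = H.index * (orderOf y * orderOf
      (QuotientGroup.mk x : C ⧸ Subgroup.zpowers y)) := by
    rw [Subgroup.card_eq_card_quotient_mul_card_subgroup (Subgroup.zpowers y),
      Nat.card_zpowers, ← S.index_mul_card, hidx, Nat.card_zpowers]
    ring
  refine ⟨Dvd.intro_left _ hcard.symm, ?_⟩
  have hpos : 0 < orderOf y * orderOf (QuotientGroup.mk x : C ⧸ Subgroup.zpowers y) :=
    Nat.mul_pos (orderOf_pos _) (orderOf_pos _)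
  have hq : Nat.card (C ⧸ H) = Nat.card C /
      (orderOf y * orderOf (QuotientGroup.mk x : C ⧸ Subgroup.zpowers y)) := by
    rw [hcard, Nat.mul_div_cancel _ hpos]; rfl
  let ε := (Finite.equivFinOfCardEq hq).symm
  refine ⟨fun k => (ε k).out, fun g => ⟨ε.symm (g : C ⧸ H), ?_⟩⟩
  simp only [Equiv.apply_symm_apply]
  have hmem : ((g : C ⧸ H).out)⁻¹ * g ∈ H := by
    rw [← QuotientGroup.eq, QuotientGroup.out_eq']
  rw [hH, Subgroup.mem_comap, ← mem_powers_iff_mem_zpowers] at hmem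
  obtain ⟨n, hn⟩ := hmem
  have hn' : (QuotientGroup.mk (x ^ n) : C ⧸ Subgroup.zpowers y) =
    QuotientGroup.mk (((g : C ⧸ H).out)⁻¹ * g) := hn
  rw [QuotientGroup.eq, ← mem_powers_iff_mem_zpowers] at hn'
  obtain ⟨e, he⟩ := hn'
  refine ⟨n, e, ?_⟩
  simp only at he
  rw [he]
  group

/-- The extension of a finite field generated by a `p`-th root of unity. -/
theorem exists_extension_primitiveRoot (F : Type) [Field F] [Fintype F] {p : ℕ} (hp : p.Prime)
    (hchar : (Fintype.card F : ZMod p) ≠ 0) :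
    ∃ (E : Type) (_ : Field E) (_ : Finite E) (_ : Algebra F E) (ζ : E),
      Module.finrank F E = orderOf (Fintype.card F : ZMod p) ∧ IsPrimitiveRoot ζ p := by
  classical
  have := Fact.mk hp
  obtain ⟨q, hq⟩ := CharP.exists F
  have := Fact.mk (CharP.char_is_prime F q)
  set f := orderOf (Fintype.card F : ZMod p)
  have hf : 0 < f := by
    have := orderOf_pos (Units.mk0 _ hchar)
    rwa [← orderOf_units, Units.val_mk0] at this
  have : NeZero f := ⟨hf.ne'⟩
  let E := FiniteField.Extension F q f
  have := Fintype.ofFinite E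
  have hdvd : p ∣ Fintype.card Eˣ := by
    rw [Fintype.card_units, Fintype.card_eq_nat_card, FiniteField.natCard_extension,
      Nat.card_eq_fintype_card, ← CharP.cast_eq_zero_iff (ZMod p),
      Nat.cast_sub (Nat.one_le_pow _ _ Fintype.card_pos)]
    simp [f, pow_orderOf_eq_one]
  obtain ⟨z, hz⟩ := exists_prime_orderOf_dvd_card p hdvd
  refine ⟨E, inferInstance, inferInstance, inferInstance, z,
    FiniteField.finrank_extension F q f, ?_⟩
  rw [IsPrimitiveRoot.coe_units_iff, ← hz]
  exact IsPrimitiveRoot.orderOf z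

section FiniteFieldExtension

variable {F E : Type*} [Field F] [Field E] [Finite E] [Algebra F E]

theorem exists_galois_pow [Fintype F] {p : ℕ} (hp : 0 < p) {ζ : E} (hζ : IsPrimitiveRoot ζ p)
    (hE : Module.finrank F E = orderOf (Fintype.card F : ZMod p)) {c e : ℕ}
    (hc : (c : ZMod p) = (Fintype.card F : ZMod p) ^ e) :
    ∃ τ : Gal(E/F), τ ζ = ζ ^ c ∧ orderOf τ = orderOf (c : ZMod p) := by
  have hpos : 0 < Module.finrank F E := Module.finrank_pos
  refine ⟨FiniteField.frobeniusAlgEquivOfAlgebraic F E ^ e, ?_, ?_⟩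
  · rw [AlgEquiv.coe_pow, FiniteField.coe_frobeniusAlgEquivOfAlgebraic_iterate]
    change ζ ^ _ = _
    rw [(hζ.isOfFinOrder hp.ne').pow_eq_pow_iff_modEq, ← hζ.eq_orderOf, ← ZMod.natCast_eq_natCast_iff, hc, Nat.cast_pow]
  · have h1 : IsOfFinOrder (FiniteField.frobeniusAlgEquivOfAlgebraic F E) := isOfFinOrder_of_finite _
    have h2 : IsOfFinOrder (Fintype.card F : ZMod p) :=
      orderOf_pos_iff.1 (hE ▸ hpos)
    rw [hc, h1.orderOf_pow, h2.orderOf_pow,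
      FiniteField.orderOf_frobeniusAlgEquivOfAlgebraic, hE]

theorem exists_prod_galois_pow_eq (τ : Gal(E/F)) (x : F) :
    ∃ γ : E, ∏ i ∈ Finset.range (orderOf τ), (τ ^ i) γ = algebraMap F E x := by
  let H := Subgroup.zpowers τ
  let K := IntermediateField.fixedField H
  obtain ⟨γ, hγ⟩ := FiniteField.norm_surjective K E (algebraMap F K x)
  refine ⟨γ, ?_⟩
  have h := Algebra.norm_eq_prod_automorphisms K γ
  rw [hγ, ← IsScalarTower.algebraMap_apply] at h
  classical
  rw [h, ← Fin.prod_univ_eq_prod_range (fun i => (τ ^ i) γ)]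
  let e1 : Fin (orderOf τ) ≃ H := finEquivZPowers (isOfFinOrder_of_finite τ)
  let e2 : H ≃* Gal(E/K) := IntermediateField.subgroupEquivAlgEquiv H
  refine Fintype.prod_equiv (e1.trans e2.toEquiv) _ _ fun i => ?_
  rfl

end FiniteFieldExtension

section TwistedSequences

variable {K E : Type*} [Field K] [Field E] [Algebra K E]

/-- The sequences `v` with `v (i + t) = T (v i)`. -/
def twistedSeq (T : Module.End K E) (t : ℕ) : Submodule K (ℕ → E) where
  carrier := {v | ∀ i, v (i + t) = T (v i)}
  add_mem' hv hw i := by simp [hv i, hw i]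
  zero_mem' i := by simp
  smul_mem' c v hv i := by simp [hv i]

variable {T : Module.End K E} {t : ℕ}

namespace twistedSeq

theorem apply_add_mul (v : twistedSeq T t) (i n : ℕ) :
    v.1 (i + t * n) = (T ^ n) (v.1 i) := by
  induction n with
  | zero => simp
  | succ n ih => rw [mul_add, mul_one, ← add_assoc, v.2, ih, pow_succ', Module.End.mul_apply]

/-- The twisted sequence with prescribed first `t` terms. -/
def extend (ht : 0 < t) (w : Fin t → E) : twistedSeq T t :=
  ⟨fun i => (T ^ (i / t)) (w ⟨i % t, Nat.mod_lt _ ht⟩), fun i => by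
    simp only [Nat.add_mod_right, Nat.add_div_right _ ht, pow_succ', Module.End.mul_apply]⟩

/-- A twisted sequence is determined by its first `t` terms, which are arbitrary. -/
noncomputable def equivFun (ht : 0 < t) : twistedSeq T t ≃ₗ[K] (Fin t → E) where
  toFun v i := v.1 i
  map_add' _ _ := rfl
  map_smul' _ _ := rfl
  invFun := extend ht
  left_inv v := by
    ext i
    have := apply_add_mul v (i % t) (i / t)
    rw [Nat.mod_add_div] at this
    exact this.symm
  right_inv w := by
    funext i
    simp [extend, Nat.div_eq_of_lt i.2, Nat.mod_eq_of_lt i.2]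

theorem finrank_eq [FiniteDimensional K E] (ht : 0 < t) :
    Module.finrank K (twistedSeq T t) = t * Module.finrank K E := by
  simp [(equivFun (T := T) ht).finrank_eq, Module.finrank_pi_fintype]

/-- The shift operator. -/
def shift : Module.End K (twistedSeq T t) where
  toFun v := ⟨fun i => v.1 (i + 1), fun i => by rw [← v.2 (i + 1)]; ring_nf⟩
  map_add' _ _ := rfl
  map_smul' _ _ := rfl

/-- Termwise multiplication by a compatible sequence. -/
def diag (μ : ℕ → E) (hμ : ∀ i x, T (μ i * x) = μ (i + t) * T x) :
    Module.End K (twistedSeq T t) where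
  toFun v := ⟨fun i => μ i * v.1 i, fun i => by simp only [hμ, v.2 i]⟩
  map_add' _ _ := Subtype.ext (funext fun _ => mul_add _ _ _)
  map_smul' _ _ := Subtype.ext (funext fun _ => mul_smul_comm _ _ _)

variable {μ : ℕ → E} (hμ : ∀ i x, T (μ i * x) = μ (i + t) * T x)

theorem shift_pow_apply (n : ℕ) (v : twistedSeq T t) (i : ℕ) :
    ((shift ^ n : Module.End K (twistedSeq T t)) v).1 i = v.1 (i + n) := by
  induction n generalizing i with
  | zero => rfl
  | succ n ih =>
    rw [pow_succ', Module.End.mul_apply, add_comm n, ← add_assoc, ← ih]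
    rfl

theorem diag_pow_apply (n : ℕ) (v : twistedSeq T t) (i : ℕ) :
    ((diag μ hμ ^ n) v).1 i = μ i ^ n * v.1 i := by
  induction n with
  | zero => simp
  | succ n ih =>
    rw [pow_succ', Module.End.mul_apply, pow_succ', mul_assoc, ← ih]
    rfl

theorem diag_pow_eq_one {p : ℕ} (h : ∀ i, μ i ^ p = 1) : diag μ hμ ^ p = 1 := by
  ext v i
  rw [diag_pow_apply, h, one_mul, Module.End.one_apply]

theorem shift_mul_diag {r : ℕ} (h : ∀ i, μ (i + 1) = μ i ^ r) :
    shift * diag μ hμ = diag μ hμ ^ r * shift := by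
  ext v i
  rw [Module.End.mul_apply (diag μ hμ ^ r), diag_pow_apply, ← h]
  rfl

theorem shift_pow_mul {F : Type*} [Field F] [Algebra F K] [Algebra F E] [IsScalarTower F K E]
    {c : F} {n : ℕ} (h : ∀ z, (T ^ n) z = algebraMap F E c * z) :
    (shift ^ (t * n) : Module.End K (twistedSeq T t)) = algebraMap F _ c := by
  ext v i
  rw [shift_pow_apply, apply_add_mul, h, ← Algebra.smul_def]
  rfl

theorem exists_apply_ne_zero (ht : 0 < t) (hT : Function.Injective T) :
    ∃ v : twistedSeq T t, ∀ i, v.1 i ≠ 0 := by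
  refine ⟨extend ht 1, fun i => ?_⟩
  have : Function.Injective (T ^ (i / t)) := by
    rw [Module.End.coe_pow]
    exact hT.iterate _
  exact (map_ne_zero_iff (T ^ (i / t)) this).2 one_ne_zero

theorem coeff_eq_zero (ht : 0 < t) (hT : Function.Injective T) {p m : ℕ}
    (x : Fin p → Fin m → K) (hinj : ∀ n, Function.Injective fun j : Fin m => μ (n + j))
    (hx : ∑ i, ∑ j, x i j • (diag μ hμ ^ (i : ℕ) * shift ^ (j : ℕ)) = 0) (n : ℕ) (j : Fin m) :
    ∑ i, algebraMap K E (x i j) * μ n ^ (i : ℕ) = 0 := by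
  obtain ⟨v, hv⟩ := exists_apply_ne_zero (T := T) ht hT
  have key := Matrix.eq_zero_of_forall_pow_sum_mul_pow_eq_zero (R := E)
    (f := fun j : Fin m => μ (n + j))
    (v := fun j => (∑ i, algebraMap K E (x i j) * μ n ^ (i : ℕ)) * v.1 (n + j)) (hinj n)
    (fun e => by
      have h := congrArg (fun S => (S ((diag μ hμ ^ (e : ℕ)) v)).1 n) hx
      simp only [LinearMap.sum_apply, LinearMap.smul_apply, Module.End.mul_apply,
        AddSubmonoidClass.coe_finsetSum, Finset.sum_apply, Submodule.coe_smul, Pi.smul_apply,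
        diag_pow_apply, shift_pow_apply, LinearMap.zero_apply, ZeroMemClass.coe_zero,
        Pi.zero_apply] at h
      rw [Finset.sum_comm] at h
      rw [← h]
      refine Finset.sum_congr rfl fun j _ => ?_
      rw [Finset.sum_mul, Finset.sum_mul]
      refine Finset.sum_congr rfl fun i _ => ?_
      rw [Algebra.smul_def]
      ring)
  exact (mul_eq_zero.1 (congrFun key j)).resolve_right (hv _)

end twistedSeq

end TwistedSequences

theorem SemiconjBy.pow_pow_of_pow {M : Type*} [Monoid M] {x y : M} {r : ℕ}
    (h : SemiconjBy y x (x ^ r)) (n k : ℕ) :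
    SemiconjBy (y ^ n) (x ^ k) (x ^ (r ^ n * k)) := by
  induction n with
  | zero => simp
  | succ n ih =>
    rw [pow_succ' y, pow_succ' r, mul_assoc, pow_mul x]
    exact (h.pow_right _).mul_left ih

theorem pow_mul_pow_mul_pow_mul_pow {M : Type*} [Monoid M] {x y : M} {r : ℕ}
    (h : SemiconjBy y x (x ^ r)) (i j k l : ℕ) :
    x ^ i * y ^ j * (x ^ k * y ^ l) = x ^ (i + r ^ j * k) * y ^ (j + l) := by
  rw [mul_assoc, ← mul_assoc (y ^ j), (h.pow_pow_of_pow j k).eq, pow_add, pow_add]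
  simp only [mul_assoc]

section TwistedGroupAlgebra

variable {p m r : ℕ} {G : Type*} [Group G] {a b : G}

theorem bijective_pow_mul_pow (hp : 0 < p) (hm : 0 < m) (ha : orderOf a = p) (hb : orderOf b = m)
    (hgen : ∀ g : G, ∃ i j : ℕ, g = a ^ i * b ^ j) (hcard : Nat.card G = p * m) :
    Function.Bijective fun ij : Fin p × Fin m => a ^ (ij.1 : ℕ) * b ^ (ij.2 : ℕ) := by
  have : Finite G := Nat.finite_of_card_ne_zero (hcard ▸ (Nat.mul_pos hp hm).ne')
  have := Fintype.ofFinite G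
  rw [Fintype.bijective_iff_surjective_and_card]
  refine ⟨fun g => ?_, by
    rw [← Nat.card_eq_fintype_card, ← Nat.card_eq_fintype_card, hcard, Nat.card_prod,
      Nat.card_fin, Nat.card_fin]⟩
  obtain ⟨i, j, rfl⟩ := hgen g
  refine ⟨(⟨i % p, Nat.mod_lt _ hp⟩, ⟨j % m, Nat.mod_lt _ hm⟩), ?_⟩
  simp only
  rw [← ha, ← hb, pow_mod_orderOf, pow_mod_orderOf]

variable {F A : Type*} [Field F] [Ring A] [Algebra F A] {lam : Fˣ} {α : G → G → Fˣ} {u : G → A}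

/-- The universal property of the twisted group algebra, in terms of generators. -/
theorem exists_basis_lift (hp : 0 < p) (hm : 0 < m)
    (ha : orderOf a = p) (hb : orderOf b = m) (hrel : b * a * b⁻¹ = a ^ r)
    (hgen : ∀ g : G, ∃ i j : ℕ, g = a ^ i * b ^ j) (hcard : Nat.card G = p * m)
    (hα : ∀ i₁ j₁ i₂ j₂ : ℕ, i₁ < p → j₁ < m → i₂ < p → j₂ < m →
      α (a ^ i₁ * b ^ j₁) (a ^ i₂ * b ^ j₂) = if j₁ + j₂ < m then 1 else lam)
    (hlin : LinearIndependent F u) (hspan : Submodule.span F (Set.range u) = ⊤)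
    (hone : u 1 = 1) (hmul : ∀ g h : G, u g * u h = ((α g h : F)) • u (g * h)) :
    ∃ B : Module.Basis (Fin p × Fin m) F A,
      ∀ {R : Type*} [Ring R] [Algebra F R] (x y : R), x ^ p = 1 →
        y ^ m = algebraMap F R lam → y * x = x ^ r * y →
        ∃ φ : A →ₐ[F] R, ∀ i j, φ (B (i, j)) = x ^ (i : ℕ) * y ^ (j : ℕ) := by
  let e := Equiv.ofBijective _ (bijective_pow_mul_pow hp hm ha hb hgen hcard)
  let B := (Module.Basis.mk hlin hspan.ge).reindex e.symm
  have hB : ∀ i j, B (i, j) = u (a ^ (i : ℕ) * b ^ (j : ℕ)) := fun i j => by simp [B, e]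
  refine ⟨B, fun {R} _ _ x y hx hy hyx => ?_⟩
  have hxp : ∀ i, x ^ (i % p) = x ^ i := fun i => by
    conv_rhs => rw [← Nat.mod_add_div i p, pow_add, pow_mul, hx, one_pow, mul_one]
  have hap : ∀ i, a ^ (i % p) = a ^ i := fun i => by rw [← ha, pow_mod_orderOf]
  let φ : A →ₗ[F] R := B.constr F fun ij => x ^ (ij.1 : ℕ) * y ^ (ij.2 : ℕ)
  have hφ : ∀ i j : ℕ, j < m → φ (u (a ^ i * b ^ j)) = x ^ i * y ^ j := fun i j hj => by
    rw [← hap, ← hxp]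
    exact (congrArg φ (hB ⟨i % p, Nat.mod_lt _ hp⟩ ⟨j, hj⟩).symm).trans (B.constr_basis _ _ _)
  have hbm : b ^ m = 1 := hb ▸ pow_orderOf_eq_one b
  have hba : SemiconjBy b a (a ^ r) := mul_inv_eq_iff_eq_mul.1 hrel
  have hmap : ∀ z w, φ (z * w) = φ z * φ w := by
    refine LinearMap.map_mul_iff φ |>.2 ?_
    refine B.ext fun ⟨i, j⟩ => B.ext fun ⟨k, l⟩ => ?_
    simp only [LinearMap.compr₂_apply, LinearMap.mul_apply', LinearMap.compl₂_apply, LinearMap.comp_apply, hB, hmul,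
      map_smul, hφ _ _ j.2, hφ _ _ l.2, hα _ _ _ _ i.2 j.2 k.2 l.2,
      pow_mul_pow_mul_pow_mul_pow hba, pow_mul_pow_mul_pow_mul_pow hyx]
    split_ifs with h
    · rw [hφ _ _ h, Units.val_one, one_smul]
    · have hjl : (j : ℕ) + l = m + (j + l - m) := by omega
      rw [hjl, pow_add b, hbm, one_mul, hφ _ _ (by omega), pow_add y, hy,
        ← mul_assoc, ← Algebra.commutes, mul_assoc, Algebra.smul_def]
  refine ⟨AlgHom.ofLinearMap φ ?_ hmap, fun i j => ?_⟩
  · simpa [hone] using hφ 0 0 hm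
  · simpa [hB] using hφ i j j.2

end TwistedGroupAlgebra

/-- A finite field extension twisted by an automorphism `τ` and a scalar which is a norm: the
semilinear operator whose `orderOf τ`-th power is the given scalar. -/
theorem exists_semilinear_pow_eq {F E : Type*} [Field F] [Field E] [Finite E] [Algebra F E]
    (τ : Gal(E/F)) (x : Fˣ) :
    ∃ (K : IntermediateField F E) (T : Module.End K E),
      Module.finrank K E = orderOf τ ∧ Function.Injective T ∧
      (∀ y z, T (y * z) = τ y * T z) ∧
      ∀ z, (T ^ orderOf τ) z = algebraMap F E x * z := by
  let H := Subgroup.zpowers τ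
  let K := IntermediateField.fixedField H
  obtain ⟨γ, hγ⟩ := exists_prod_galois_pow_eq τ (x : F)
  have hγ0 : γ ≠ 0 := by
    rintro rfl
    have : algebraMap F E x = 0 := by
      rw [← hγ]
      exact Finset.prod_eq_zero (Finset.mem_range.2 (orderOf_pos τ)) (map_zero _)
    exact x.ne_zero ((map_eq_zero _).1 this)
  let T : Module.End K E :=
    { toFun := fun z => γ * τ z
      map_add' := fun y z => by rw [map_add, mul_add]
      map_smul' := fun c z => by
        have hc : τ c = c := c.2 ⟨τ, Subgroup.mem_zpowers τ⟩
        rw [Algebra.smul_def, map_mul, RingHom.id_apply, Algebra.smul_def,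
          IntermediateField.algebraMap_apply, hc]
        ring }
  have hT : ∀ z, T z = γ * τ z := fun _ => rfl
  have hTn : ∀ n z, (T ^ n) z = (∏ i ∈ Finset.range n, (τ ^ i) γ) * (τ ^ n) z := by
    intro n z
    induction n with
    | zero => simp
    | succ n ih =>
      rw [pow_succ', Module.End.mul_apply, ih, hT, map_mul, map_prod, Finset.prod_range_succ',
        pow_zero, AlgEquiv.one_apply]
      simp only [pow_succ', AlgEquiv.mul_apply]
      ring
  refine ⟨K, T, ?_, fun y z h => τ.injective (mul_left_cancel₀ hγ0 h), fun y z => ?_, fun z => ?_⟩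
  · rw [IntermediateField.finrank_fixedField_eq_card, Nat.card_zpowers]
  · rw [hT, hT, map_mul]; ring
  · rw [hTn, hγ, pow_orderOf_eq_one, AlgEquiv.one_apply]

section QuotientXPowSubC

open Polynomial

variable {F : Type*} [Field F] (m : ℕ) (c : F)

theorem mk_X_pow_eq_algebraMap :
    Ideal.Quotient.mk (Ideal.span ({X ^ m - C c} : Set F[X])) X ^ m =
      algebraMap F (F[X] ⧸ Ideal.span ({X ^ m - C c} : Set F[X])) c := by
  rw [← map_pow, ← sub_eq_zero]
  change _ - Ideal.Quotient.mk _ (C c) = 0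
  rw [← map_sub, Ideal.Quotient.eq_zero_iff_mem]
  exact Ideal.mem_span_singleton_self _

theorem finrank_quotient_X_pow_sub_C :
    Module.finrank F (F[X] ⧸ Ideal.span ({X ^ m - C c} : Set F[X])) = m := by
  rw [finrank_quotient_span_eq_natDegree, natDegree_X_pow_sub_C]

variable {m c}

theorem coeff_eq_zero_of_sum_smul_mk_X_pow (hm : 0 < m) (w : Fin m → F)
    (h : ∑ j, w j • Ideal.Quotient.mk (Ideal.span ({X ^ m - C c} : Set F[X])) X ^ (j : ℕ) = 0)
    (j : Fin m) : w j = 0 := by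
  have hmem : Ideal.Quotient.mk (Ideal.span ({X ^ m - C c} : Set F[X]))
      (∑ j, C (w j) * X ^ (j : ℕ)) = 0 := by
    rw [← h, map_sum]
    refine Finset.sum_congr rfl fun j _ => ?_
    rw [← map_pow, ← smul_eq_C_mul]
    rfl
  rw [Ideal.Quotient.eq_zero_iff_mem, Ideal.mem_span_singleton] at hmem
  have h0 : ∑ j, C (w j) * X ^ (j : ℕ) = 0 := by
    refine eq_zero_of_dvd_of_degree_lt hmem ?_
    rw [degree_X_pow_sub_C hm]
    exact degree_sum_fin_lt w
  have h1 := congrArg (fun P : F[X] => P.coeff j) h0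
  simpa [finsetSum_coeff, coeff_C_mul, coeff_X_pow, Fin.val_inj] using h1

theorem finrank_quotient_prod_matrix {K : Type*} [Field K] [Algebra F K] [FiniteDimensional F K]
    (hm : 0 < m) (n N : ℕ) :
    Module.finrank F ((F[X] ⧸ Ideal.span ({X ^ m - C c} : Set F[X])) ×
      (Fin N → Matrix (Fin n) (Fin n) K)) = m + N * (n ^ 2 * Module.finrank F K) := by
  have : FiniteDimensional F (F[X] ⧸ Ideal.span ({X ^ m - C c} : Set F[X])) :=
    Module.finite_of_finrank_pos (by rwa [finrank_quotient_X_pow_sub_C])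
  have : FiniteDimensional F (Matrix (Fin n) (Fin n) K) := Module.Finite.matrix
  rw [Module.finrank_prod, finrank_quotient_X_pow_sub_C, Module.finrank_pi_fintype]
  simp only [Module.finrank_matrix, Finset.sum_const, Finset.card_univ, Fintype.card_fin,
    smul_eq_mul]
  ring

end QuotientXPowSubC

theorem IsPrimitiveRoot.pow_eq_pow_iff_natCast {M : Type*} [CommMonoid M] {ζ : M} {p : ℕ}
    (hp : 0 < p) (hζ : IsPrimitiveRoot ζ p) {i j : ℕ} :
    ζ ^ i = ζ ^ j ↔ (i : ZMod p) = j := by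
  rw [(hζ.isOfFinOrder hp.ne').pow_eq_pow_iff_modEq, ← hζ.eq_orderOf, ZMod.natCast_eq_natCast_iff]

/-- A polynomial of degree less than `p` over a finite field vanishing at `1` and at enough
nontrivial `p`-th roots of unity is zero. -/
theorem coeff_eq_zero_of_cosetReps {F E : Type*} [Field F] [Fintype F] [Field E]
    [Algebra F E] {p : ℕ} [Fact p.Prime] {ζ : E} (hζ : IsPrimitiveRoot ζ p) (r : ℕ)
    (ru ℓu : (ZMod p)ˣ) (hru : (ru : ZMod p) = r) (hℓu : (ℓu : ZMod p) = Fintype.card F)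
    {ι : Type*} (κ : ι → (ZMod p)ˣ) (hκ : ∀ g, ∃ (k : _) (n e : ℕ), g = κ k * ru ^ n * ℓu ^ e)
    (w : Fin p → F) (h1 : ∑ i, w i = 0)
    (hw : ∀ k n, ∑ i, algebraMap F E (w i) * (ζ ^ ((κ k : ZMod p).val * r ^ n)) ^ (i : ℕ) = 0) :
    w = 0 := by
  have hp : 0 < p := (Fact.out : p.Prime).pos
  have key := Matrix.eq_zero_of_forall_index_sum_mul_pow_eq_zero (R := E)
    (f := fun g : Fin p => ζ ^ (g : ℕ)) (v := fun i => algebraMap F E (w i))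
    (fun g g' hg => Fin.ext (hζ.pow_inj g.2 g'.2 hg)) (fun g => by
      by_cases hg : ((g : ℕ) : ZMod p) = 0
      · have : ζ ^ (g : ℕ) = 1 := by
          rw [← pow_zero ζ, hζ.pow_eq_pow_iff_natCast hp, hg, Nat.cast_zero]
        simp only [this, one_pow, mul_one]
        rw [← map_sum, h1, map_zero]
      · obtain ⟨k, n, e, hk⟩ := hκ (Units.mk0 _ hg)
        have hk' : ζ ^ (g : ℕ) = (ζ ^ ((κ k : ZMod p).val * r ^ n)) ^ (Fintype.card F ^ e) := by
          rw [← pow_mul, hζ.pow_eq_pow_iff_natCast hp]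
          have := congrArg Units.val hk
          simpa [hru, hℓu] using this
        have h := congrArg (fun z => ((FiniteField.frobeniusAlgHom F E ^ e) z)) (hw k n)
        simp only [map_sum, map_mul, map_pow, AlgHom.commutes, map_zero] at h
        rw [← h]
        refine Finset.sum_congr rfl fun i _ => ?_
        rw [hk', AlgHom.coe_pow, FiniteField.coe_frobeniusAlgHom, pow_iterate]
        simp only [← pow_mul]
        ring_nf)
  funext i
  exact (map_eq_zero _).1 (congrFun key i)

set_option maxHeartbeats 1600000 in

/-- **complete Wedderburn decomposition.** With `G = C_p ⋊_r C_m`,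
`F` a finite field with `ℓ` elements of characteristic different from `p`,
`α` the inflation of `α_λ` along `G → C_m`, and `A = F^α G` the twisted group
algebra, let `f = ord_p(ℓ)`, let `t` be the order of the image of `r` in
`(ℤ/pℤ)^×/⟨ℓ⟩`, `h = m/t`, `s = ord_p(r^t)` and `d = f/s`. Then `h·s` is a perfect
square, and writing `ρ = √(h·s)` and `u = (p-1)/(f·t)`, there is an `F`-algebra
isomorphism `A ≅ F[X]/(X^m - λ) × ∏_{j=1}^{u} M_{t·ρ}(K_j)` with each `K_j` a field
extension of `F` of degree `d`. In particular `dim_F A = p·m = |G|`. -/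
theorem twisted_group_algebra_wedderburn (p m r ℓ : ℕ) (hp : p.Prime) (hodd : Odd p)
    (hm : 1 < m) (hmp : m ∣ p - 1)
    (hr : orderOf ((r : ZMod p)) = m)
    (G : Type) [Group G] (a b : G)
    (ha : orderOf a = p) (hb : orderOf b = m)
    (hrel : b * a * b⁻¹ = a ^ r)
    (hgen : ∀ g : G, ∃ i j : ℕ, g = a ^ i * b ^ j)
    (hcard : Nat.card G = p * m)
    (F : Type) [Field F] [Fintype F]
    (hF : Fintype.card F = ℓ) (hchar : ringChar F ≠ p)
    (lam : Fˣ)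
    (α : G → G → Fˣ)
    (hα : ∀ i₁ j₁ i₂ j₂ : ℕ, i₁ < p → j₁ < m → i₂ < p → j₂ < m →
      α (a ^ i₁ * b ^ j₁) (a ^ i₂ * b ^ j₂) = if j₁ + j₂ < m then 1 else lam)
    (A : Type) [Ring A] [Algebra F A]
    (u : G → A)
    (hlin : LinearIndependent F u)
    (hspan : Submodule.span F (Set.range u) = ⊤)
    (hone : u 1 = 1)
    (hmul : ∀ g h : G, u g * u h = ((α g h : F)) • u (g * h))
    -- the residue classes of `r` and `ℓ` as units modulo `p`
    (ru ℓu : (ZMod p)ˣ)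
    (hru : (ru : ZMod p) = (r : ZMod p)) (hℓu : (ℓu : ZMod p) = (ℓ : ZMod p))
    -- the numerical invariants
    (f t h s d : ℕ)
    (hf : f = orderOf ((ℓ : ZMod p)))
    (ht : t = orderOf (QuotientGroup.mk ru : (ZMod p)ˣ ⧸ Subgroup.zpowers ℓu))
    (hh : h = m / t)
    (hs : s = orderOf ((r : ZMod p) ^ t))
    (hd : d = f / s) :
    ∃ ρ : ℕ, ρ ^ 2 = h * s ∧
      (∃ (K : Fin ((p - 1) / (f * t)) → Type)
          (_ : ∀ j, Field (K j)) (_ : ∀ j, Algebra F (K j)),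
        (∀ j, Module.finrank F (K j) = d) ∧
        Nonempty (A ≃ₐ[F]
          (Polynomial F ⧸ Ideal.span
              ({Polynomial.X ^ m - Polynomial.C ((lam : F))} : Set (Polynomial F))) ×
            ((j : Fin ((p - 1) / (f * t))) →
              Matrix (Fin (t * ρ)) (Fin (t * ρ)) (K j)))) ∧
      Module.finrank F A = p * m := by
  have := Fact.mk hp
  have hp0 := hp.pos
  have hm0 : 0 < m := by omega
  subst hF
  have hru_ord : orderOf ru = m := by rw [← orderOf_units, hru, hr]
  have hf' : orderOf ℓu = f := by rw [← orderOf_units, hℓu, hf]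
  have hcardU : Nat.card (ZMod p)ˣ = p - 1 := by
    rw [Nat.card_eq_fintype_card, ZMod.card_units]
  have ht0 : 0 < t := ht ▸ orderOf_pos _
  have htm : t ∣ m := by
    rw [ht, ← hru_ord]
    exact orderOf_map_dvd (QuotientGroup.mk' (Subgroup.zpowers ℓu)) ru
  have hthm : t * h = m := hh ▸ Nat.mul_div_cancel' htm
  have hsh : s = h := by
    rw [hs, orderOf_pow_of_dvd ht0.ne' (hr ▸ htm), hr, hh]
  have hreps := exists_cosetReps ru ℓu
  rw [← ht, hf', hcardU] at hreps
  obtain ⟨N, hN⟩ : ∃ N, N = (p - 1) / (f * t) := ⟨_, rfl⟩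
  rw [← hN] at hreps ⊢
  obtain ⟨hdvd, κ, hκ⟩ := hreps
  have hNft : N * (f * t) = p - 1 := hN ▸ Nat.div_mul_cancel hdvd
  obtain ⟨e, he⟩ : ∃ e : ℕ, ru ^ t = ℓu ^ e := by
    have h1 : (QuotientGroup.mk (ru ^ t) : (ZMod p)ˣ ⧸ Subgroup.zpowers ℓu) = 1 := by
      rw [QuotientGroup.mk_pow, ht, pow_orderOf_eq_one]
    rw [QuotientGroup.eq_one_iff, ← mem_powers_iff_mem_zpowers] at h1
    obtain ⟨e, he⟩ := h1
    exact ⟨e, he.symm⟩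
  obtain ⟨E, _, _, _, ζ, hE, hζ⟩ := exists_extension_primitiveRoot F hp (hℓu ▸ ℓu.ne_zero)
  have hc : ((r ^ t : ℕ) : ZMod p) = (Fintype.card F : ZMod p) ^ e := by
    rw [Nat.cast_pow, ← hru, ← hℓu]
    exact_mod_cast he
  obtain ⟨τ, hτ, hτord⟩ := exists_galois_pow hp0 hζ hE hc
  rw [Nat.cast_pow, ← hs, hsh] at hτord
  obtain ⟨K, T, hKE, hTinj, hTmul, hTpow⟩ := exists_semilinear_pow_eq τ lam
  rw [hτord] at hKE hTpow
  have hh0 : 0 < h := Nat.pos_of_mul_pos_left (hthm ▸ hm0)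
  have hFK : Module.finrank F K = d := by
    have := Module.finrank_mul_finrank F K E
    rw [hE, ← hf, hKE] at this
    rw [hd, hsh, ← this, Nat.mul_div_cancel _ hh0]
  have hV : Module.finrank K (twistedSeq T t) = m := by
    rw [twistedSeq.finrank_eq ht0, hKE, hthm]
  have := Module.Finite.equiv (twistedSeq.equivFun (T := T) ht0).symm
  let μ : Fin N → ℕ → E := fun k n => ζ ^ ((κ k : ZMod p).val * r ^ n)
  have hμ : ∀ k i x, T (μ k i * x) = μ k (i + t) * T x := fun k i x => by
    simp only [μ, hTmul, map_pow, hτ, ← pow_mul]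
    ring_nf
  let Q := Polynomial F ⧸ Ideal.span
    ({Polynomial.X ^ m - Polynomial.C (lam : F)} : Set (Polynomial F))
  obtain ⟨B, hB⟩ := exists_basis_lift hp0 hm0 ha hb hrel hgen hcard hα hlin hspan hone hmul
  have hA : Module.finrank F A = p * m := by
    simp [Module.finrank_eq_card_basis B]
  obtain ⟨φ, hφ⟩ := hB (R := Q × (Fin N → Module.End K (twistedSeq T t)))
    (1, fun k => twistedSeq.diag (μ k) (hμ k))
    (Ideal.Quotient.mk _ Polynomial.X, fun _ => twistedSeq.shift)
    (Prod.ext (one_pow p) (funext fun k => twistedSeq.diag_pow_eq_one (hμ k) fun i => by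
      rw [← pow_mul, mul_comm, pow_mul, hζ.pow_eq_one, one_pow]))
    (Prod.ext (mk_X_pow_eq_algebraMap m (lam : F)) (funext fun _ =>
      (congrArg (twistedSeq.shift ^ ·) hthm.symm).trans (twistedSeq.shift_pow_mul hTpow)))
    (Prod.ext (by simp only [Prod.fst_mul, Prod.pow_fst, one_pow, one_mul, mul_one])
      (funext fun k => twistedSeq.shift_mul_diag (hμ k) fun i => by
        simp only [μ, ← pow_mul, pow_succ, mul_assoc]))
  have hinj : Function.Injective φ := by
    rw [injective_iff_map_eq_zero]
    intro z hz
    have hz' : ∑ i, ∑ j, B.repr z (i, j) • φ (B (i, j)) = 0 := by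
      rw [← hz, ← Fintype.sum_prod_type' fun i j => B.repr z (i, j) • φ (B (i, j))]
      conv_rhs => rw [← B.sum_repr z, map_sum]
      simp only [map_smul]
    simp only [hφ] at hz'
    have h1 : ∀ j, ∑ i, B.repr z (i, j) = 0 := by
      refine coeff_eq_zero_of_sum_smul_mk_X_pow (c := (lam : F)) hm0 _ ?_
      have h := congrArg Prod.fst hz'
      rw [Finset.sum_comm] at h
      simpa only [Prod.fst_sum, Prod.smul_fst, Prod.fst_mul, Prod.pow_fst, one_pow, one_mul,
        Prod.fst_zero, ← Finset.sum_smul] using h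
    have h2 : ∀ k n j, ∑ i, algebraMap F E (B.repr z (i, j)) * μ k n ^ (i : ℕ) = 0 := by
      intro k n j
      have h := congrArg (fun P => P.2 k) hz'
      simp only [Prod.snd_sum, Finset.sum_apply, Prod.smul_snd, Pi.smul_apply, Prod.snd_mul,
        Pi.mul_apply, Prod.pow_snd, Pi.pow_apply, Prod.snd_zero, Pi.zero_apply] at h
      refine twistedSeq.coeff_eq_zero (hμ k) ht0 hTinj
        (fun i j => algebraMap F K (B.repr z (i, j))) (fun n j j' hjj => ?_) ?_ n j
      · simp only [μ] at hjj
        rw [hζ.pow_eq_pow_iff_natCast hp0] at hjj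
        simp only [Nat.cast_mul, ZMod.natCast_val, ZMod.cast_id', id, Nat.cast_pow, ← hru] at hjj
        have hu : κ k * ru ^ (n + (j : ℕ)) = κ k * ru ^ (n + (j' : ℕ)) := Units.ext (by simpa using hjj)
        rw [pow_add, pow_add, mul_right_inj, mul_right_inj] at hu
        exact Fin.ext (pow_injOn_Iio_orderOf (by simp [hru_ord]) (by simp [hru_ord]) hu)
      · rw [← h]
        simp only [algebraMap_smul]
    refine B.ext_elem fun ⟨i, j⟩ => ?_
    rw [map_zero, Finsupp.zero_apply]
    exact congrFun (coeff_eq_zero_of_cosetReps hζ r ru ℓu hru hℓu κ hκ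
      (fun i => B.repr z (i, j)) (h1 j) fun k n => h2 k n j) i
  have hdim : Module.finrank F A =
      Module.finrank F (Q × (Fin N → Matrix (Fin m) (Fin m) K)) := by
    have hdh : d * h = f := by
      rw [hf, ← hE, ← Module.finrank_mul_finrank F K E, hFK, hKE]
    have hpN : p = N * (f * t) + 1 := by omega
    rw [hA, finrank_quotient_prod_matrix hm0, hFK, hpN, ← hdh, ← hthm]
    ring
  have hQ : FiniteDimensional F (Q × (Fin N → Matrix (Fin m) (Fin m) K)) :=
    Module.finite_of_finrank_pos (hdim ▸ hA ▸ Nat.mul_pos hp0 hm0)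
  have hAfin : FiniteDimensional F A := Module.Finite.of_basis B
  let ψ : (Q × (Fin N → Module.End K (twistedSeq T t))) ≃ₐ[F]
      Q × (Fin N → Matrix (Fin m) (Fin m) K) :=
    AlgEquiv.prodCongr AlgEquiv.refl (AlgEquiv.piCongrRight fun _ =>
      (algEquivMatrix (Module.finBasisOfFinrankEq K _ hV)).restrictScalars F)
  have hψφ : Function.Injective (ψ.toAlgHom.comp φ) := ψ.injective.comp hinj
  have hbij : Function.Bijective (ψ.toAlgHom.comp φ) :=
    ⟨hψφ, (LinearMap.injective_iff_surjective_of_finrank_eq_finrank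
      (f := (ψ.toAlgHom.comp φ).toLinearMap) hdim).1 hψφ⟩
  refine ⟨h, by rw [hsh, sq], ⟨fun _ => K, fun _ => inferInstance, fun _ => inferInstance,
    fun _ => hFK, ?_⟩, hA⟩
  rw [hthm]
  exact ⟨AlgEquiv.ofBijective _ hbij⟩
end

section
/- Assume that the residue class of r modulo p lies in the subgroup ⟨ℓ⟩ of (ℤ/pℤ)^× generated by ℓ (equivalently, every Frobenius orbit of nontrivial characters of C_p is stable under the C_m-action), and let s be the multiplicative order of r modulo p. Then s divides f, m · s is a perfect square, and there is an F-algebra isomorphism A ≅ F[X]/(X^m − λ) × ∏_{j=1}^{(p−1)/f} M_{√(m·s)}(K_j), where each K_j is a field extension of F of degree f/s. -/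
namespace MetacyclicTwisted

section Presentation

theorem pow_mul_pow_of_mul_eq {R : Type*} [Monoid R] {x y : R} {r : ℕ}
    (h : y * x = x ^ r * y) (j k : ℕ) : y ^ j * x ^ k = x ^ (r ^ j * k) * y ^ j := by
  induction j generalizing k with
  | zero => simp
  | succ j ih =>
    have hk : y * x ^ k = x ^ (r * k) * y := by
      rw [pow_mul]
      exact SemiconjBy.pow_right (show SemiconjBy y x (x ^ r) from h) k
    rw [pow_succ, mul_assoc, hk, ← mul_assoc, ih, mul_assoc, pow_succ, mul_assoc]

theorem monomial_mul_monomial {R : Type*} [Monoid R] {x y : R} {r : ℕ}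
    (h : y * x = x ^ r * y) (i j k l : ℕ) :
    x ^ i * y ^ j * (x ^ k * y ^ l) = x ^ (i + r ^ j * k) * y ^ (j + l) := by
  rw [mul_assoc, ← mul_assoc (y ^ j), pow_mul_pow_of_mul_eq h, pow_add, pow_add]
  simp only [mul_assoc]

theorem monomial_eq_smul {F R : Type*} [CommRing F] [Ring R] [Algebra F R] {p m : ℕ} {lam : F}
    {x y : R} (hx : x ^ p = 1) (hy : y ^ m = algebraMap F R lam) (i j : ℕ) :
    x ^ i * y ^ j = lam ^ (j / m) • (x ^ (i % p) * y ^ (j % m)) := by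
  conv_lhs => rw [← Nat.mod_add_div i p, ← Nat.mod_add_div' j m]
  rw [pow_add, pow_mul, hx, one_pow, mul_one, pow_add, mul_comm (j / m), pow_mul, hy, ← map_pow,
    ← Algebra.commutes, ← Algebra.smul_def, mul_smul_comm]

/-- An algebra with a basis of monomials `x ^ i * y ^ j` subject to the relations `x ^ p = 1`,
`y ^ m = lam`, `y * x = x ^ r * y` is presented by these relations. -/
theorem exists_algHom_of_basis {F A R : Type*} [CommRing F] [Ring A] [Algebra F A] [Ring R]
    [Algebra F R] {p m r : ℕ} (hp : 0 < p) (hm : 0 < m) {lam : F} {x y : A} {X Y : R}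
    (hx : x ^ p = 1) (hy : y ^ m = algebraMap F A lam) (hyx : y * x = x ^ r * y)
    (hX : X ^ p = 1) (hY : Y ^ m = algebraMap F R lam) (hYX : Y * X = X ^ r * Y)
    (B : Module.Basis (Fin p × Fin m) F A)
    (hB : ∀ i, B i = x ^ (i.1 : ℕ) * y ^ (i.2 : ℕ)) :
    ∃ φ : A →ₐ[F] R, φ x = X ∧ φ y = Y := by
  let L : A →ₗ[F] R := B.constr F fun i => X ^ (i.1 : ℕ) * Y ^ (i.2 : ℕ)
  have hL (i j : ℕ) : L (x ^ i * y ^ j) = X ^ i * Y ^ j := by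
    rw [monomial_eq_smul hx hy, monomial_eq_smul hX hY, map_smul]
    have := B.constr_basis F (fun i => X ^ (i.1 : ℕ) * Y ^ (i.2 : ℕ))
      (⟨i % p, Nat.mod_lt _ hp⟩, ⟨j % m, Nat.mod_lt _ hm⟩)
    rw [hB] at this
    rw [← this]
  have hmul (a b : A) : L (a * b) = L a * L b := by
    have : (LinearMap.mul F A).compr₂ L = (LinearMap.mul F R).compl₁₂ L L := by
      refine B.ext fun i => B.ext fun k => ?_
      simp only [LinearMap.compr₂_apply, LinearMap.mul_apply', LinearMap.compl₁₂_apply, hB, hL,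
        monomial_mul_monomial hyx, monomial_mul_monomial hYX]
    exact LinearMap.congr_fun₂ this a b
  refine ⟨AlgHom.ofLinearMap L (by simpa using hL 0 0) hmul, ?_, ?_⟩
  · simpa using hL 1 0
  · simpa using hL 0 1

end Presentation

section CyclicAction

variable {K E : Type*} [Field K] [Field E] [Algebra K E]

/-- The semilinear operator `e ↦ μ * σ e`. -/
noncomputable def twist (σ : E ≃ₐ[K] E) (μ : E) : Module.End K E :=
  LinearMap.mulLeft K μ * σ.toLinearMap

theorem twist_apply (σ : E ≃ₐ[K] E) (μ e : E) : twist σ μ e = μ * σ e := rfl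

theorem twist_pow_apply (σ : E ≃ₐ[K] E) (μ e : E) (j : ℕ) :
    (twist σ μ ^ j) e = (∏ i ∈ Finset.range j, (σ ^ i) μ) * (σ ^ j) e := by
  induction j generalizing e with
  | zero => simp
  | succ j ih =>
    rw [pow_succ, Module.End.mul_apply, ih, twist_apply, map_mul, Finset.prod_range_succ, pow_succ,
      AlgEquiv.mul_apply, mul_assoc]

theorem twist_mul_mulLeft (σ : E ≃ₐ[K] E) (μ z : E) (r : ℕ) (hz : σ z = z ^ r) :
    twist σ μ * LinearMap.mulLeft K z = LinearMap.mulLeft K z ^ r * twist σ μ := by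
  ext e
  simp only [Module.End.mul_apply, LinearMap.pow_mulLeft, LinearMap.mulLeft_apply, twist_apply,
    map_mul, hz]
  ring

theorem prod_range_pow_eq_norm [FiniteDimensional K E] [IsGalois K E] (σ : E ≃ₐ[K] E)
    (hσ : orderOf σ = Module.finrank K E) (μ : E) :
    ∏ i ∈ Finset.range (Module.finrank K E), (σ ^ i) μ = algebraMap K E (Algebra.norm K μ) := by
  rw [Algebra.norm_eq_prod_automorphisms, ← hσ, ← Fin.prod_univ_eq_prod_range (fun i => (σ ^ i) μ)]
  have hinj : Function.Injective fun i : Fin (orderOf σ) => σ ^ (i : ℕ) := fun i j h =>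
    Fin.ext (pow_injOn_Iio_orderOf i.2 j.2 h)
  refine Fintype.prod_bijective (fun i : Fin (orderOf σ) => σ ^ (i : ℕ))
    (hinj.bijective_of_nat_card_le ?_) _ _ fun _ => rfl
  rw [IsGalois.card_aut_eq_finrank, Nat.card_fin, hσ]

theorem twist_pow_finrank [FiniteDimensional K E] [IsGalois K E] (σ : E ≃ₐ[K] E)
    (hσ : orderOf σ = Module.finrank K E) (μ : E) :
    twist σ μ ^ Module.finrank K E = algebraMap K (Module.End K E) (Algebra.norm K μ) := by
  ext e
  rw [twist_pow_apply, prod_range_pow_eq_norm σ hσ, ← hσ, pow_orderOf_eq_one,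
    Module.algebraMap_end_apply, Algebra.smul_def, AlgEquiv.one_apply]

/-- Dedekind's independence of characters, for the powers of a twist. -/
theorem eq_zero_of_sum_mul_twist_pow (σ : E ≃ₐ[K] E) {m : ℕ} (hσ : orderOf σ = m) {μ : E}
    (hμ : μ ≠ 0) (c : Fin m → E)
    (hc : ∀ e, ∑ j, c j * (twist σ μ ^ (j : ℕ)) e = 0) (j : Fin m) : c j = 0 := by
  have hinj : Function.Injective fun j : Fin m => ((σ ^ (j : ℕ) : E ≃ₐ[K] E) : E →* E) := by
    intro i j h
    refine Fin.ext (pow_injOn_Iio_orderOf (x := σ) (hσ ▸ i.2) (hσ ▸ j.2) ?_)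
    exact AlgEquiv.ext fun e => DFunLike.congr_fun h e
  have hli := (linearIndependent_monoidHom E E).comp _ hinj
  have key := Fintype.linearIndependent_iff.1 hli
    (fun j => c j * ∏ i ∈ Finset.range j, (σ ^ i) μ) (by
      ext e
      simpa [twist_pow_apply, mul_assoc] using hc e) j
  refine (mul_eq_zero.1 key).resolve_right (Finset.prod_ne_zero_iff.2 fun i _ => ?_)
  exact (EmbeddingLike.map_ne_zero_iff (f := σ ^ i)).2 hμ

end CyclicAction

section Cosets

theorem exists_zpowers_transversal {G : Type*} [CommGroup G] [Finite G] (g : G) :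
    ∃ T : Fin (Nat.card G / orderOf g) → G, ∀ v, ∃ j, ∃ k : ℕ, v = T j * g ^ k := by
  have hcard : Nat.card (G ⧸ Subgroup.zpowers g) = Nat.card G / orderOf g := by
    rw [Subgroup.card_eq_card_quotient_mul_card_subgroup (Subgroup.zpowers g), Nat.card_zpowers,
      Nat.mul_div_cancel _ (orderOf_pos g)]
  let e := (Finite.equivFinOfCardEq hcard).symm
  refine ⟨fun j => (e j).out, fun v => ⟨e.symm v, ?_⟩⟩
  have h : (QuotientGroup.mk (e (e.symm v)).out : G ⧸ Subgroup.zpowers g) = v := by simp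
  rw [QuotientGroup.eq, ← mem_powers_iff_mem_zpowers] at h
  obtain ⟨k, hk⟩ := h
  exact ⟨k, by simpa [eq_inv_mul_iff_mul_eq, eq_comm] using hk⟩

end Cosets

section Cyclotomic

variable {F E : Type*} [Field F] [Field E] [Algebra F E] {p : ℕ} {ζ : E}

theorem pow_eq_pow_iff_natCast_eq [NeZero p] (hζ : IsPrimitiveRoot ζ p) {i j : ℕ} :
    ζ ^ i = ζ ^ j ↔ (i : ZMod p) = j := by
  have : IsOfFinOrder ζ := isOfFinOrder_iff_pow_eq_one.2 ⟨p, NeZero.pos p, hζ.pow_eq_one⟩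
  rw [this.pow_eq_pow_iff_modEq, ← hζ.eq_orderOf, ZMod.natCast_eq_natCast_iff]

/-- The order of an automorphism is read off from its action on a generating root of unity. -/
theorem orderOf_algEquiv_eq [NeZero p] (hζ : IsPrimitiveRoot ζ p) (htop : Algebra.adjoin F {ζ} = ⊤)
    (σ : E ≃ₐ[F] E) (r : ℕ) (hσ : σ ζ = ζ ^ r) : orderOf σ = orderOf (r : ZMod p) := by
  have hpow (k : ℕ) : (σ ^ k) ζ = ζ ^ r ^ k := by
    induction k with
    | zero => simp
    | succ k ih => rw [pow_succ, AlgEquiv.mul_apply, hσ, map_pow, ih, ← pow_mul, pow_succ]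
  refine orderOf_eq_orderOf_iff.2 fun k => ?_
  have h1 : (r : ZMod p) ^ k = 1 ↔ ζ ^ r ^ k = ζ ^ 1 := by
    rw [pow_eq_pow_iff_natCast_eq hζ, Nat.cast_pow, Nat.cast_one]
  rw [h1, ← hpow, pow_one]
  refine ⟨fun h => by rw [h, AlgEquiv.one_apply], fun h => ?_⟩
  have : ((σ ^ k : E ≃ₐ[F] E) : E →ₐ[F] E) = AlgHom.id F E :=
    AlgHom.ext_of_adjoin_eq_top htop (by simpa using h)
  exact AlgEquiv.ext fun e => DFunLike.congr_fun this e

theorem frobenius_pow_apply [Fintype F] [FiniteDimensional F E] (k : ℕ) (e : E) :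
    (FiniteField.frobeniusAlgEquivOfAlgebraic F E ^ k) e = e ^ Fintype.card F ^ k := by
  rw [AlgEquiv.coe_pow, FiniteField.coe_frobeniusAlgEquivOfAlgebraic_iterate]

theorem finrank_eq_orderOf_card [Fintype F] [FiniteDimensional F E] [NeZero p]
    (hζ : IsPrimitiveRoot ζ p)
    (htop : Algebra.adjoin F {ζ} = ⊤) :
    Module.finrank F E = orderOf (Fintype.card F : ZMod p) := by
  have := Module.finite_of_finite F (M := E)
  rw [← FiniteField.orderOf_frobeniusAlgEquivOfAlgebraic F E]
  refine orderOf_algEquiv_eq hζ htop _ _ ?_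
  simp

end Cyclotomic

section Faithful

open Polynomial

theorem coeff_fin_sum {F : Type*} [Semiring F] {m : ℕ} (c : Fin m → F) (j : Fin m) :
    (∑ i : Fin m, C (c i) * X ^ (i : ℕ)).coeff j = c j := by
  simp [coeff_X_pow, Fin.val_inj]

theorem eq_zero_of_sum_smul_root_pow {F : Type*} [Field F] {g : F[X]} {m : ℕ}
    (hdeg : g.natDegree = m) (hm : 0 < m) (c : Fin m → F)
    (hc : ∑ j, c j • AdjoinRoot.root g ^ (j : ℕ) = 0) (j : Fin m) : c j = 0 := by
  have hdvd : g ∣ ∑ i : Fin m, C (c i) * X ^ (i : ℕ) := by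
    rw [← AdjoinRoot.mk_eq_zero, ← hc, map_sum]
    refine Finset.sum_congr rfl fun i _ => ?_
    rw [map_mul, map_pow, AdjoinRoot.mk_X, AdjoinRoot.mk_C, Algebra.smul_def]
    rfl
  rw [← coeff_fin_sum c, eq_zero_of_dvd_of_degree_lt hdvd, coeff_zero]
  rw [degree_eq_natDegree (ne_zero_of_natDegree_gt (hm.trans_eq hdeg.symm)), hdeg]
  exact degree_sum_fin_lt c

theorem finrank_adjoinRoot {F : Type*} [Field F] {g : F[X]} (hg : g ≠ 0) :
    Module.finrank F (AdjoinRoot g) = g.natDegree := by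
  rw [(AdjoinRoot.powerBasis hg).finrank, AdjoinRoot.powerBasis_dim]

theorem map_eq_sum_of_basis {F A R : Type*} [CommRing F] [Ring A] [Algebra F A] [Ring R]
    [Algebra F R] {p m : ℕ} {x y : A} (B : Module.Basis (Fin p × Fin m) F A)
    (hB : ∀ i, B i = x ^ (i.1 : ℕ) * y ^ (i.2 : ℕ)) (ψ : A →ₐ[F] R) (z : A) :
    ψ z = ∑ j : Fin m, ∑ i : Fin p, B.repr z (i, j) • (ψ x ^ (i : ℕ) * ψ y ^ (j : ℕ)) := by
  conv_lhs => rw [← B.sum_repr z]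
  rw [map_sum, Fintype.sum_prod_type_right]
  simp [hB]

/-- An element of a twisted metacyclic algebra killed by the augmentation and by one
representation for each Frobenius orbit of nontrivial characters vanishes. -/
theorem eq_zero_of_forall_map_eq_zero {F K E A ι : Type*} [Field F] [Fintype F] [Field K] [Field E]
    [Algebra F K] [Algebra K E] [Algebra F E] [IsScalarTower F K E] [FiniteDimensional F E]
    [Ring A] [Algebra F A] {p m : ℕ} (hm : 0 < m) {ζ : E} (hζ : IsPrimitiveRoot ζ p)
    {x y : A} (B : Module.Basis (Fin p × Fin m) F A)
    (hB : ∀ i, B i = x ^ (i.1 : ℕ) * y ^ (i.2 : ℕ)) (lam : F)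
    (φ₀ : A →ₐ[F] AdjoinRoot (X ^ m - C lam)) (hx₀ : φ₀ x = 1) (hy₀ : φ₀ y = AdjoinRoot.root _)
    (σ : E ≃ₐ[K] E) (hσ : orderOf σ = m) {μ : E} (hμ : μ ≠ 0) (t : ι → ℕ)
    (ht : ∀ n < p, n ≠ 0 → ∃ j k, ζ ^ n = (ζ ^ t j) ^ Fintype.card F ^ k)
    (φ : ι → A →ₐ[F] Module.End K E) (hx : ∀ j, φ j x = LinearMap.mulLeft K (ζ ^ t j))
    (hy : ∀ j, φ j y = twist σ μ) {z : A} (hz₀ : φ₀ z = 0) (hz : ∀ j, φ j z = 0) : z = 0 := by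
  let P (j : Fin m) : F[X] := ∑ i : Fin p, C (B.repr z (i, j)) * X ^ (i : ℕ)
  have hP1 (j : Fin m) : (P j).eval 1 = 0 := by
    refine eq_zero_of_sum_smul_root_pow (g := X ^ m - C lam) natDegree_X_pow_sub_C hm
      (fun j => (P j).eval 1) ?_ j
    rw [← hz₀, map_eq_sum_of_basis B hB φ₀, hx₀, hy₀]
    simp [P, eval_finsetSum, Finset.sum_smul]
  have hPt (l : ι) (j : Fin m) : aeval (ζ ^ t l) (P j) = 0 := by
    refine eq_zero_of_sum_mul_twist_pow σ hσ hμ (fun j => aeval (ζ ^ t l) (P j)) (fun e => ?_) j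
    have := LinearMap.congr_fun ((map_eq_sum_of_basis B hB (φ l) z).symm.trans (hz l)) e
    rw [hx, hy] at this
    simpa [P, Finset.sum_mul, LinearMap.pow_mulLeft, Algebra.smul_def, mul_assoc] using this
  have hPn (j : Fin m) (n : Fin p) : (((P j).map (algebraMap F E)).eval (ζ ^ (n : ℕ))) = 0 := by
    rw [eval_map_algebraMap]
    rcases eq_or_ne (n : ℕ) 0 with hn | hn
    · rw [hn, pow_zero, ← map_one (algebraMap F E), aeval_algebraMap_apply, coe_aeval_eq_eval, hP1,
        map_zero]
    · obtain ⟨l, k, h⟩ := ht n n.2 hn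
      rw [h, ← frobenius_pow_apply, aeval_algHom_apply, hPt, map_zero]
  have hP (j : Fin m) : P j = 0 := by
    by_contra hne
    refine hne ((Polynomial.map_eq_zero_iff (algebraMap F E).injective).1 ?_)
    refine eq_zero_of_natDegree_lt_card_of_eval_eq_zero _
      (f := fun n : Fin p => ζ ^ (n : ℕ)) (fun i j h => Fin.ext (hζ.pow_inj i.2 j.2 h))
      (hPn j) ?_
    rw [natDegree_map, Fintype.card_fin]
    exact (natDegree_lt_iff_degree_lt hne).2 (degree_sum_fin_lt _)
  refine B.repr.map_eq_zero_iff.1 (Finsupp.ext fun ⟨i, j⟩ => ?_)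
  have := congrArg (fun q => q.coeff i) (hP j)
  rwa [coeff_fin_sum (fun i => B.repr z (i, j)), coeff_zero] at this

end Faithful

section Decomposition

open Polynomial

/-- An automorphism seen as an automorphism over its own fixed field. -/
theorem exists_algEquiv_fixedField {F E : Type*} [Field F] [Field E] [Algebra F E]
    [FiniteDimensional F E] (σ : E ≃ₐ[F] E) :
    ∃ τ : E ≃ₐ[IntermediateField.fixedField (Subgroup.zpowers σ)] E,
      (∀ e, τ e = σ e) ∧ orderOf τ = orderOf σ := by
  refine ⟨IntermediateField.subgroupEquivAlgEquiv (Subgroup.zpowers σ)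
    ⟨σ, Subgroup.mem_zpowers σ⟩, fun e => rfl, ?_⟩
  rw [MulEquiv.orderOf_eq, Subgroup.orderOf_mk]

/-- The representation of the twisted algebra on `E` given by `x ↦ ζ` and `y ↦ μ * σ`, where `μ`
has norm `lam`. -/
theorem exists_algHom_end {F K E A : Type*} [Field F] [Field K] [Field E] [Algebra F K]
    [Algebra K E] [Algebra F E] [IsScalarTower F K E] [FiniteDimensional K E] [IsGalois K E]
    [Ring A] [Algebra F A] {p m r : ℕ} (hp : 0 < p) (hm : 0 < m) {ζ : E} (hζ : ζ ^ p = 1)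
    {lam : F} {x y : A} (hx : x ^ p = 1) (hy : y ^ m = algebraMap F A lam)
    (hyx : y * x = x ^ r * y) (B : Module.Basis (Fin p × Fin m) F A)
    (hB : ∀ i, B i = x ^ (i.1 : ℕ) * y ^ (i.2 : ℕ)) (σ : E ≃ₐ[K] E) (hσ : orderOf σ = m)
    (hEK : Module.finrank K E = m) (hσζ : σ ζ = ζ ^ r) {μ : E}
    (hμ : Algebra.norm K μ = algebraMap F K lam) :
    ∃ φ : A →ₐ[F] Module.End K E, φ x = LinearMap.mulLeft K ζ ∧ φ y = twist σ μ := by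
  refine exists_algHom_of_basis hp hm hx hy hyx ?_ ?_ (twist_mul_mulLeft σ μ ζ r hσζ) B hB
  · rw [LinearMap.pow_mulLeft, hζ, LinearMap.mulLeft_one]
    rfl
  · rw [← hEK, twist_pow_finrank σ (hσ.trans hEK.symm), hμ, ← IsScalarTower.algebraMap_apply]

theorem decomposition_of_basis {F K E A : Type*} [Field F] [Fintype F] [Field K] [Field E]
    [Algebra F K] [Algebra K E] [Algebra F E] [IsScalarTower F K E] [FiniteDimensional F E]
    [FiniteDimensional F K] [FiniteDimensional K E] [IsGalois K E] [Finite E]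
    [Ring A] [Algebra F A] {p m r n : ℕ} (hp : 0 < p) (hm : 0 < m) {ζ : E}
    (hζ : IsPrimitiveRoot ζ p) {lam : F} (hlam : lam ≠ 0) {x y : A} (hx : x ^ p = 1)
    (hy : y ^ m = algebraMap F A lam) (hyx : y * x = x ^ r * y)
    (B : Module.Basis (Fin p × Fin m) F A)
    (hB : ∀ i, B i = x ^ (i.1 : ℕ) * y ^ (i.2 : ℕ)) (σ : E ≃ₐ[K] E) (hσ : orderOf σ = m)
    (hEK : Module.finrank K E = m) (hσζ : σ ζ = ζ ^ r) (t : Fin n → ℕ)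
    (ht : ∀ i < p, i ≠ 0 → ∃ j k, ζ ^ i = (ζ ^ t j) ^ Fintype.card F ^ k)
    (hn : n * Module.finrank F E = p - 1) :
    Nonempty (A ≃ₐ[F] AdjoinRoot (X ^ m - C lam) × (Fin n → Matrix (Fin m) (Fin m) K)) := by
  have hg : (X ^ m - C lam) ≠ 0 := X_pow_sub_C_ne_zero hm lam
  have : Finite K := Finite.of_injective _ (algebraMap K E).injective
  obtain ⟨μ, hμ⟩ := FiniteField.norm_surjective K E (algebraMap F K lam)
  have hμ0 : μ ≠ 0 := by
    rintro rfl
    rw [Algebra.norm_zero] at hμ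
    exact hlam ((map_eq_zero _).1 hμ.symm)
  obtain ⟨φ₀, hx₀, hy₀⟩ := exists_algHom_of_basis (X := (1 : AdjoinRoot (X ^ m - C lam)))
    (Y := AdjoinRoot.root _) hp hm hx hy hyx (one_pow p)
    (by
      have := AdjoinRoot.eval₂_root (X ^ m - C lam)
      rw [eval₂_sub, eval₂_X_pow, eval₂_C, sub_eq_zero] at this
      exact this) (by simp) B hB
  have hrep (j : Fin n) := exists_algHom_end hp hm (ζ := ζ ^ t j)
    (by rw [← pow_mul, mul_comm, pow_mul, hζ.pow_eq_one, one_pow]) hx hy hyx B hB σ hσ hEK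
    (by rw [map_pow, hσζ, ← pow_mul, ← pow_mul, mul_comm]) hμ
  choose φ hφx hφy using hrep
  let e : Module.End K E ≃ₐ[F] Matrix (Fin m) (Fin m) K :=
    (algEquivMatrix (Module.finBasisOfFinrankEq K E hEK)).restrictScalars F
  let Ψ : A →ₐ[F] AdjoinRoot (X ^ m - C lam) × (Fin n → Matrix (Fin m) (Fin m) K) :=
    φ₀.prod (AlgHom.pi fun j => (e : Module.End K E →ₐ[F] _).comp (φ j))
  have hinj : Function.Injective Ψ := by
    refine (injective_iff_map_eq_zero Ψ).2 fun z hz => ?_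
    refine eq_zero_of_forall_map_eq_zero hm hζ B hB lam φ₀ hx₀ hy₀ σ hσ hμ0 t ht φ hφx hφy
      (congrArg Prod.fst hz) fun j => ?_
    exact e.map_eq_zero_iff.1 (congrFun (congrArg Prod.snd hz) j)
  have : Module.Finite F A := Module.Finite.of_basis B
  have : Module.Finite F (AdjoinRoot (X ^ m - C lam)) :=
    Module.Finite.of_basis (AdjoinRoot.powerBasis hg).basis
  have hdim : Module.finrank F A =
      Module.finrank F (AdjoinRoot (X ^ m - C lam) × (Fin n → Matrix (Fin m) (Fin m) K)) := by
    rw [Module.finrank_eq_card_basis B, Module.finrank_prod, finrank_adjoinRoot hg,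
      natDegree_X_pow_sub_C, Module.finrank_pi_fintype]
    simp only [Module.finrank_matrix, Finset.sum_const, Finset.card_univ, Fintype.card_prod,
      Fintype.card_fin, smul_eq_mul]
    rw [← Module.finrank_mul_finrank F K E, hEK] at hn
    calc p * m = (p - 1 + 1) * m := by rw [Nat.sub_add_cancel hp]
      _ = _ := by rw [← hn]; ring
  exact ⟨AlgEquiv.ofBijective Ψ ⟨hinj,
    (LinearMap.injective_iff_surjective_of_finrank_eq_finrank (f := Ψ.toLinearMap) hdim).1 hinj⟩⟩

end Decomposition

section TwistedGroupAlgebra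

variable {G F A : Type*} [Group G] [Field F] [Ring A] [Algebra F A] {p m r : ℕ} {a b : G}
  {lam : Fˣ} {α : G → G → Fˣ} {u : G → A}

theorem bijective_pow_mul_pow (hp : 0 < p) (hm : 0 < m) (ha : orderOf a = p) (hb : orderOf b = m)
    (hgen : ∀ g : G, ∃ i j : ℕ, g = a ^ i * b ^ j) (hcard : Nat.card G = p * m) :
    Function.Bijective fun i : Fin p × Fin m => a ^ (i.1 : ℕ) * b ^ (i.2 : ℕ) := by
  refine Function.Surjective.bijective_of_nat_card_le (fun g => ?_) (by simp [hcard])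
  obtain ⟨i, j, rfl⟩ := hgen g
  refine ⟨(⟨i % p, Nat.mod_lt _ hp⟩, ⟨j % m, Nat.mod_lt _ hm⟩), ?_⟩
  simp only [← ha, ← hb, pow_mod_orderOf]

/-- A twisted group algebra inflated from `C_m` has a basis of monomials in two generators. -/
theorem exists_generators (hp : 0 < p) (hm : 1 < m) (ha : orderOf a = p) (hb : orderOf b = m)
    (hrel : b * a * b⁻¹ = a ^ r) (hgen : ∀ g : G, ∃ i j : ℕ, g = a ^ i * b ^ j)
    (hcard : Nat.card G = p * m)
    (hα : ∀ i₁ j₁ i₂ j₂ : ℕ, i₁ < p → j₁ < m → i₂ < p → j₂ < m →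
      α (a ^ i₁ * b ^ j₁) (a ^ i₂ * b ^ j₂) = if j₁ + j₂ < m then 1 else lam)
    (hlin : LinearIndependent F u) (hspan : Submodule.span F (Set.range u) = ⊤) (hone : u 1 = 1)
    (hmul : ∀ g h : G, u g * u h = ((α g h : F)) • u (g * h)) :
    ∃ (x y : A) (B : Module.Basis (Fin p × Fin m) F A),
      x ^ p = 1 ∧ y ^ m = algebraMap F A lam ∧ y * x = x ^ r * y ∧
      ∀ i, B i = x ^ (i.1 : ℕ) * y ^ (i.2 : ℕ) := by
  have hm0 : 0 < m := zero_lt_one.trans hm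
  have hα' (i j k l : ℕ) (hj : j < m) (hl : l < m) :
      α (a ^ i * b ^ j) (a ^ k * b ^ l) = if j + l < m then 1 else lam := by
    rw [← hα (i % p) j (k % p) l (Nat.mod_lt _ hp) hj (Nat.mod_lt _ hp) hl, ← ha,
      pow_mod_orderOf, pow_mod_orderOf]
  have hapow (i : ℕ) : u a ^ i = u (a ^ i) := by
    induction i with
    | zero => simp [hone]
    | succ i ih =>
      have := hα' i 0 1 0 hm0 hm0
      simp only [pow_zero, mul_one, pow_one, add_zero, hm0, if_true] at this
      rw [pow_succ, ih, hmul, this, Units.val_one, one_smul, pow_succ]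
  have hbpow (j : ℕ) (hj : j < m) : u b ^ j = u (b ^ j) := by
    induction j with
    | zero => simp [hone]
    | succ j ih =>
      have := hα' 0 j 0 1 (by omega) hm
      simp only [pow_zero, one_mul, pow_one, hj, if_true] at this
      rw [pow_succ, ih (by omega), hmul, this, Units.val_one, one_smul, pow_succ]
  have hab (i j : ℕ) (hj : j < m) : u a ^ i * u b ^ j = u (a ^ i * b ^ j) := by
    have := hα' i 0 0 j hm0 hj
    simp only [pow_zero, mul_one, one_mul, zero_add, hj, if_true] at this
    rw [hapow, hbpow j hj, hmul, this, Units.val_one, one_smul]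
  have hrel' : b * a = a ^ r * b := by rw [← hrel]; group
  let e := Equiv.ofBijective _ (bijective_pow_mul_pow hp hm0 ha hb hgen hcard)
  refine ⟨u a, u b, (Module.Basis.mk hlin hspan.ge).reindex e.symm, ?_, ?_, ?_, fun i => ?_⟩
  · rw [hapow, ← ha, pow_orderOf_eq_one, hone]
  · have := hα' 0 (m - 1) 0 1 (by omega) hm
    simp only [pow_zero, one_mul, pow_one, Nat.sub_add_cancel hm.le, lt_irrefl, if_false] at this
    rw [← Nat.sub_add_cancel hm.le, pow_succ, hbpow _ (by omega), hmul, this, ← pow_succ,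
      Nat.sub_add_cancel hm.le, ← hb, pow_orderOf_eq_one, hone, Algebra.algebraMap_eq_smul_one]
  · have := hα' 0 1 1 0 hm hm0
    simp only [pow_zero, one_mul, pow_one, mul_one, add_zero, hm, if_true] at this
    have h := hab r 1 hm
    rw [pow_one, pow_one] at h
    rw [h, hmul, this, Units.val_one, one_smul, hrel']
  · rw [Module.Basis.reindex_apply, Module.Basis.mk_apply, hab _ _ i.2.2]
    rfl

end TwistedGroupAlgebra

end MetacyclicTwisted

/-- **fixed-orbit case.** With `G = C_p ⋊_r C_m`, `F` a finite field
with `ℓ` elements of characteristic different from `p`, `α` the inflation of `α_λ`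
along `G → C_m`, `A = F^α G` the twisted group algebra, and `f = ord_p(ℓ)`: if the
residue class of `r` mod `p` lies in the subgroup `⟨ℓ⟩` of `(ℤ/pℤ)^×` (i.e. every
Frobenius orbit of nontrivial characters of `C_p` is stable under the `C_m`-action),
and `s` denotes the multiplicative order of `r` mod `p`, then `s ∣ f`, `m·s` is a
perfect square, and `A ≅ F[X]/(X^m - λ) × ∏_{j=1}^{(p-1)/f} M_{√(m·s)}(K_j)` as
`F`-algebras, where each `K_j` is a field extension of `F` of degree `f/s`. -/
theorem twisted_group_algebra_wedderburn_stable (p m r ℓ : ℕ)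
    (hp : p.Prime) (hodd : Odd p)
    (hm : 1 < m) (hmp : m ∣ p - 1)
    (hr : orderOf ((r : ZMod p)) = m)
    (G : Type) [Group G] (a b : G)
    (ha : orderOf a = p) (hb : orderOf b = m)
    (hrel : b * a * b⁻¹ = a ^ r)
    (hgen : ∀ g : G, ∃ i j : ℕ, g = a ^ i * b ^ j)
    (hcard : Nat.card G = p * m)
    (F : Type) [Field F] [Fintype F]
    (hF : Fintype.card F = ℓ) (hchar : ringChar F ≠ p)
    (lam : Fˣ)
    (α : G → G → Fˣ)
    (hα : ∀ i₁ j₁ i₂ j₂ : ℕ, i₁ < p → j₁ < m → i₂ < p → j₂ < m →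
      α (a ^ i₁ * b ^ j₁) (a ^ i₂ * b ^ j₂) = if j₁ + j₂ < m then 1 else lam)
    (A : Type) [Ring A] [Algebra F A]
    (u : G → A)
    (hlin : LinearIndependent F u)
    (hspan : Submodule.span F (Set.range u) = ⊤)
    (hone : u 1 = 1)
    (hmul : ∀ g h : G, u g * u h = ((α g h : F)) • u (g * h))
    (ru ℓu : (ZMod p)ˣ)
    (hru : (ru : ZMod p) = (r : ZMod p)) (hℓu : (ℓu : ZMod p) = (ℓ : ZMod p))
    (f : ℕ) (hf : f = orderOf ((ℓ : ZMod p)))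
    (hstable : ru ∈ Subgroup.zpowers ℓu)
    (s : ℕ) (hs : s = orderOf ((r : ZMod p))) :
    s ∣ f ∧
      ∃ ρ : ℕ, ρ ^ 2 = m * s ∧
        ∃ (K : Fin ((p - 1) / f) → Type)
            (_ : ∀ j, Field (K j)) (_ : ∀ j, Algebra F (K j)),
          (∀ j, Module.finrank F (K j) = f / s) ∧
          Nonempty (A ≃ₐ[F]
            (Polynomial F ⧸ Ideal.span
                ({Polynomial.X ^ m - Polynomial.C ((lam : F))} : Set (Polynomial F))) ×
              ((j : Fin ((p - 1) / f)) → Matrix (Fin ρ) (Fin ρ) (K j))) := by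
  have : Fact p.Prime := ⟨hp⟩
  have hm0 : 0 < m := zero_lt_one.trans hm
  obtain rfl : s = m := hs.trans hr
  have hpF : (p : F) ≠ 0 := fun h => hchar <|
    (CharP.ringChar_of_prime_eq_zero hp h)
  have : NeZero (p : F) := ⟨hpF⟩
  let E := CyclotomicField p F
  have : FiniteDimensional F E := IsCyclotomicExtension.finiteDimensional {p} F E
  have : Finite E := Module.finite_of_finite F
  have hζ : IsPrimitiveRoot (IsCyclotomicExtension.zeta p F E) p :=
    IsCyclotomicExtension.zeta_spec p F E
  set ζ := IsCyclotomicExtension.zeta p F E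
  have htop : Algebra.adjoin F {ζ} = ⊤ := IsCyclotomicExtension.adjoin_primitive_root_eq_top hζ
  have hEf : Module.finrank F E = f := by
    rw [MetacyclicTwisted.finrank_eq_orderOf_card hζ htop, hF, hf]
  rw [← mem_powers_iff_mem_zpowers] at hstable
  obtain ⟨k, hk⟩ := hstable
  have hrk : (r : ZMod p) = (ℓ ^ k : ℕ) := by
    rw [← hru, ← hk, Nat.cast_pow, Units.val_pow_eq_pow_val, hℓu]
  let σ := FiniteField.frobeniusAlgEquivOfAlgebraic F E ^ k
  have hσζ : σ ζ = ζ ^ r := by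
    rw [MetacyclicTwisted.frobenius_pow_apply, hF,
      (MetacyclicTwisted.pow_eq_pow_iff_natCast_eq hζ).2 hrk]
  have hσ : orderOf σ = s := (MetacyclicTwisted.orderOf_algEquiv_eq hζ htop σ r hσζ).trans hr
  let K := IntermediateField.fixedField (Subgroup.zpowers σ)
  have hEK : Module.finrank K E = s := by
    rw [IntermediateField.finrank_fixedField_eq_card, Nat.card_zpowers, hσ]
  have hKf : Module.finrank F K * s = f := by
    rw [← hEf, ← hEK, Module.finrank_mul_finrank]
  obtain ⟨τ, hτ, hτo⟩ := MetacyclicTwisted.exists_algEquiv_fixedField σ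
  have hℓf : orderOf ℓu = f := by rw [hf, ← hℓu, orderOf_units]
  have hcardU : Nat.card (ZMod p)ˣ = p - 1 := by
    rw [Nat.card_eq_fintype_card, ZMod.card_units]
  have htrans := MetacyclicTwisted.exists_zpowers_transversal ℓu
  rw [hcardU, hℓf] at htrans
  obtain ⟨T, hT⟩ := htrans
  have hfp : f ∣ p - 1 := by rw [← hℓf, ← hcardU]; exact orderOf_dvd_natCard ℓu
  obtain ⟨x, y, B, hx, hy, hyx, hB⟩ := MetacyclicTwisted.exists_generators hp.pos hm ha hb hrel hgen
    hcard hα hlin hspan hone hmul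
  refine ⟨⟨_, (mul_comm _ _).trans hKf |>.symm⟩, s, sq s, fun _ => K, fun _ => inferInstance,
    fun _ => inferInstance, fun _ => (Nat.div_eq_of_eq_mul_left hm0 hKf.symm).symm, ?_⟩
  refine MetacyclicTwisted.decomposition_of_basis (K := K) (E := E) hp.pos hm0 hζ lam.ne_zero hx hy
    hyx B hB τ (hτo.trans hσ) hEK ((hτ ζ).trans hσζ) (fun j => ((T j : ZMod p)).val) ?_ ?_
  · intro i hi hi0
    have hi' : (i : ZMod p) ≠ 0 := by
      rw [Ne, ZMod.natCast_eq_zero_iff]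
      exact fun h => hi0 (Nat.eq_zero_of_dvd_of_lt h hi)
    obtain ⟨j, n, h⟩ := hT (Units.mk0 _ hi')
    refine ⟨j, n, ?_⟩
    rw [← pow_mul, MetacyclicTwisted.pow_eq_pow_iff_natCast_eq hζ, hF]
    have := congrArg Units.val h
    simpa [hℓu] using this
  · rw [hEf, Nat.div_mul_cancel hfp]
end
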